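/- arXiv:2411.17322 — 3 statements merged into one kernel-verified Lean document; each statement's English description precedes it below -/
import Mathlib

section
/- Let k ≥ 5 and t = ⌊(k-1)/2⌋. Let G be a 2-connected graph on n vertices containing no cycle of length ≥ k, and let C be a longest cycle of G of length c = k−1, with c ≤ n−1. Set m = |A_{⌊c/2⌋}| where A_{⌊c/2⌋} = {u ∈ V(G)∖V(C) : d_C(u) = ⌊c/2⌋}. Then e(G) ≤ e(G[C]) + t·m + (t − 1/2)·(n − c − m). -/
open SimpleGraph

section Defs

variable {V α β : Type*}

/-- `G` contains a copy of `F` as a (not necessarily induced) subgraph. -/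
def ContainsCopy (F : SimpleGraph α) (G : SimpleGraph β) : Prop :=
  ∃ f : α → β, Function.Injective f ∧ ∀ ⦃a b⦄, F.Adj a b → G.Adj (f a) (f b)

/-- The number of edges of `G`. -/
noncomputable def edgeCount (G : SimpleGraph V) : ℕ := G.edgeSet.ncard

/-- `G` has a cycle of length at least `k`, i.e. `G` is not `𝓒_{≥k}`-free. -/
def HasCycleGE (G : SimpleGraph V) (k : ℕ) : Prop :=
  ∃ (v : V) (w : G.Walk v v), w.IsCycle ∧ k ≤ w.length

/-- `G` is 2-connected: it has at least 3 vertices, is connected, and stays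
connected after deleting any single vertex. -/
def TwoConnected [Fintype V] (G : SimpleGraph V) : Prop :=
  3 ≤ Fintype.card V ∧ G.Connected ∧ ∀ v : V, (G.induce ({v}ᶜ : Set V)).Connected

/-- `p(F) ≥ s`: for every proper 2-coloring of `F` both color classes have size
at least `s` (vacuously true for nonbipartite `F`, where `p(F) = ∞`). -/
def PGE [Fintype α] (F : SimpleGraph α) (s : ℕ) : Prop :=
  ∀ c : α → Bool, (∀ a b, F.Adj a b → c a ≠ c b) →
    s ≤ {a | c a = true}.ncard ∧ s ≤ {a | c a = false}.ncard

/-- `S` is a vertex covering of `F`: the complement of `S` is independent. -/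
def IsVertexCovering (F : SimpleGraph α) (S : Set α) : Prop :=
  ∀ a b, a ∉ S → b ∉ S → ¬ F.Adj a b

/-- `G` is `𝓗`-free, where `𝓗 = {F[S] : S is a vertex covering of F}`. -/
def CoverFree (F : SimpleGraph α) (G : SimpleGraph β) : Prop :=
  ∀ S : Set α, IsVertexCovering F S → ¬ ContainsCopy (F.induce S) G

/-- The maximum number of edges of an `n`-vertex graph satisfying `P`
(a generic Turán-type extremal number). -/
noncomputable def exMax (n : ℕ) (P : SimpleGraph (Fin n) → Prop) : ℕ :=
  sSup {m | ∃ G : SimpleGraph (Fin n), P G ∧ edgeCount G = m}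

/-- The number of edges of `G` with both endpoints in `T`, i.e. `e(G[T])`. -/
noncomputable def edgesWithin (G : SimpleGraph V) (T : Set V) : ℕ :=
  {e ∈ G.edgeSet | ∀ x ∈ e, x ∈ T}.ncard

/-- The number of edges of `G` with both endpoints outside `T`, i.e. `e(G−T)`. -/
noncomputable def edgesOutside (G : SimpleGraph V) (T : Set V) : ℕ :=
  {e ∈ G.edgeSet | ∀ x ∈ e, x ∉ T}.ncard

/-- The number of edges of `G` with exactly one endpoint in `T`, i.e. `e(G−T, T)`. -/
noncomputable def edgesCross (G : SimpleGraph V) (T : Set V) : ℕ :=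
  {e ∈ G.edgeSet | ∃ a b, e = s(a, b) ∧ a ∈ T ∧ b ∉ T}.ncard

/-- The number of neighbors of `u` lying in `T` (e.g. `d_C(u)` for `T = V(C)`). -/
noncomputable def degOn (G : SimpleGraph V) (T : Set V) (u : V) : ℕ :=
  {x ∈ T | G.Adj u x}.ncard

/-- The join `T ∨ I_b` of a graph `T` on `Fin a` with an independent set of
`b` vertices. -/
def joinIndep (a b : ℕ) (T : SimpleGraph (Fin a)) : SimpleGraph (Fin a ⊕ Fin b) :=
  SimpleGraph.fromRel (fun x y =>
    x.isLeft ≠ y.isLeft ∨ ∃ u v, x = Sum.inl u ∧ y = Sum.inl v ∧ T.Adj u v)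

end Defs

/-- `Pth G K a b`: there is a path in `G` from `a` to `b` with vertex set exactly `K`. -/
inductive Pth {V : Type*} [DecidableEq V] (G : SimpleGraph V) : Finset V → V → V → Prop
  | nil (a : V) : Pth G {a} a a
  | cons {K : Finset V} {a a' b : V} (h : G.Adj a a') (ha : a ∉ K) (p : Pth G K a' b) :
      Pth G (insert a K) a b

namespace Pth

variable {V : Type*} [DecidableEq V] {G : SimpleGraph V}

theorem left_mem {K : Finset V} {a b : V} (p : Pth G K a b) : a ∈ K := by
  cases p <;> simp

theorem right_mem {K : Finset V} {a b : V} (p : Pth G K a b) : b ∈ K := by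
  induction p with
  | nil a => simp
  | cons h ha p ih => exact Finset.mem_insert_of_mem ih

theorem edge {a b : V} (h : G.Adj a b) : Pth G {a, b} a b :=
  Pth.cons h (by simpa using h.ne) (Pth.nil b)

theorem trans {K L : Finset V} {a b c : V} (p : Pth G K a b) (q : Pth G L b c)
    (h : ∀ v ∈ K, v ∈ L → v = b) : Pth G (K ∪ L) a c := by
  induction p with
  | nil a => 
    have : ({a} : Finset V) ∪ L = L := by
      ext v; simp; rintro rfl; exact q.left_mem
    rwa [this]
  | @cons K a a' b hadj ha p ih =>
    rw [Finset.insert_union]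
    refine Pth.cons hadj ?_ (ih q ?_)
    · intro hm
      rcases Finset.mem_union.1 hm with hm | hm
      · exact ha hm
      · have := h a (by simp) hm
        subst this
        exact ha p.right_mem
    · intro v hv hv'
      exact h v (by simp [hv]) hv'

theorem symm {K : Finset V} {a b : V} (p : Pth G K a b) : Pth G K b a := by
  induction p with
  | nil a => exact Pth.nil a
  | @cons K a a' b hadj ha p ih =>
    have := ih.trans (edge hadj.symm) (by
      intro v hv hv'
      simp at hv'
      rcases hv' with rfl | rfl
      · rfl
      · exact absurd hv ha)
    convert this using 1
    ext v
    simp only [Finset.mem_insert, Finset.mem_union, Finset.mem_singleton]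
    constructor
    · rintro (rfl | h) <;> simp_all
    · rintro (h | rfl | rfl)
      · simp [h]
      · exact Or.inr p.left_mem
      · simp

/-- The first vertex on a path satisfying a predicate. -/
theorem first {K : Finset V} {a b : V} (p : Pth G K a b) (P : V → Prop)
    (h : ∃ v ∈ K, P v) : ∃ K₁ K₂ q, Pth G K₁ a q ∧ Pth G K₂ q b ∧ K₁ ∪ K₂ = K ∧
      (∀ v ∈ K₁, v ∈ K₂ → v = q) ∧ P q ∧ ∀ v ∈ K₁, P v → v = q := by
  induction p with
  | nil a =>
    obtain ⟨v, hv, hP⟩ := h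
    simp at hv; subst hv
    exact ⟨{v}, {v}, v, nil v, nil v, by simp, by simp, hP, by simp⟩
  | @cons K a a' b hadj ha p ih =>
    by_cases hPa : P a
    · refine ⟨{a}, insert a K, a, nil a, cons hadj ha p, by simp, by simp, hPa, by simp⟩
    · obtain ⟨v, hv, hP⟩ := h
      have hv' : v ∈ K := by
        rcases Finset.mem_insert.1 hv with rfl | h
        · exact absurd hP hPa
        · exact h
      obtain ⟨K₁, K₂, q, p1, p2, hu, hd, hq, hf⟩ := ih ⟨v, hv', hP⟩
      have ha1 : a ∉ K₁ := fun h => ha (hu ▸ Finset.mem_union_left _ h)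
      have ha2 : a ∉ K₂ := fun h => ha (hu ▸ Finset.mem_union_right _ h)
      refine ⟨insert a K₁, K₂, q, cons hadj ha1 p1, p2, by rw [Finset.insert_union, hu], ?_, hq, ?_⟩
      · intro v hv hv2
        rcases Finset.mem_insert.1 hv with rfl | h
        · exact absurd hv2 ha2
        · exact hd v h hv2
      · intro v hv hv2
        rcases Finset.mem_insert.1 hv with rfl | h
        · exact absurd hv2 hPa
        · exact hf v h hv2

/-- Remove the first vertex. -/
theorem uncons {K : Finset V} {a b : V} (p : Pth G K a b) (hab : a ≠ b) :
    ∃ a', G.Adj a a' ∧ Pth G (K.erase a) a' b := by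
  cases p with
  | nil => exact absurd rfl hab
  | cons h ha p => exact ⟨_, h, by rwa [Finset.erase_insert ha]⟩

/-- Split just before `e`. -/
theorem split {K : Finset V} {a b e : V} (p : Pth G K a b) (he : e ∈ K) (hae : a ≠ e) :
    ∃ K₁ K₂ e', Pth G K₁ a e' ∧ Pth G K₂ e b ∧ G.Adj e' e ∧ K₁ ∪ K₂ = K ∧
      (∀ v ∈ K₁, v ∉ K₂) := by
  obtain ⟨K₁, K₂, q, p1, p2, hu, hd, rfl, -⟩ := p.first (fun v => v = e) ⟨e, he, rfl⟩
  obtain ⟨e', hadj, p'⟩ := p1.symm.uncons (Ne.symm hae)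
  refine ⟨_, K₂, e', p'.symm, p2, hadj.symm, ?_, ?_⟩
  · rw [← hu]
    ext v
    simp only [Finset.mem_union, Finset.mem_erase]
    constructor
    · tauto
    · rintro (h | h)
      · by_cases hv : v = q
        · subst hv; exact Or.inr p2.left_mem
        · exact Or.inl ⟨hv, h⟩
      · exact Or.inr h
  · intro v hv hv2
    rw [Finset.mem_erase] at hv
    exact hv.1 (hd v hv.2 hv2)

theorem join {K L : Finset V} {a b c d : V} (p : Pth G K a b) (q : Pth G L c d)
    (hadj : G.Adj b c) (h : ∀ v ∈ K, v ∉ L) : Pth G (K ∪ L) a d := by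
  have hb : b ∉ L := h b p.right_mem
  have := p.trans (Pth.cons hadj hb q) (by
    intro v hv hv2
    rcases Finset.mem_insert.1 hv2 with rfl | h'
    · rfl
    · exact absurd h' (h v hv))
  convert this using 1
  ext v
  simp only [Finset.mem_insert, Finset.mem_union]
  constructor
  · tauto
  · rintro (h | rfl | h)
    · tauto
    · exact Or.inl p.right_mem
    · tauto

theorem toWalk {K : Finset V} {a b : V} (p : Pth G K a b) :
    ∃ w : G.Walk a b, w.IsPath ∧ w.length + 1 = K.card ∧ ∀ v, v ∈ w.support ↔ v ∈ K := by
  induction p with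
  | nil a => exact ⟨Walk.nil, by simp, by simp, by simp⟩
  | @cons K a a' b hadj ha p ih =>
    obtain ⟨w, hw, hl, hs⟩ := ih
    refine ⟨Walk.cons hadj w, ?_, ?_, ?_⟩
    · rw [Walk.cons_isPath_iff]; exact ⟨hw, by rwa [hs]⟩
    · simp [Finset.card_insert_of_notMem ha, hl]
    · simp [hs]

theorem ofWalk {a b : V} (w : G.Walk a b) (hw : w.IsPath) : Pth G w.support.toFinset a b := by
  induction w with
  | nil => simpa using Pth.nil _
  | cons h w ih =>
    rw [Walk.cons_isPath_iff] at hw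
    rw [Walk.support_cons, List.toFinset_cons]
    exact Pth.cons h (by simpa using hw.2) (ih hw.1)

theorem exists_cycle {K : Finset V} {a b : V} (p : Pth G K a b) (h : G.Adj b a)
    (hK : 3 ≤ K.card) : ∃ w : G.Walk b b, w.IsCycle ∧ w.length = K.card := by
  obtain ⟨w, hw, hl, -⟩ := p.toWalk
  refine ⟨Walk.cons h w, ?_, by simpa using hl⟩
  rw [Walk.cons_isCycle_iff]
  refine ⟨hw, ?_⟩
  cases w with
  | nil => simp at hl; omega
  | cons h1 w1 =>
    rw [Walk.cons_isPath_iff] at hw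
    rw [Walk.edges_cons, List.mem_cons]
    rintro (h2 | h2)
    · rw [Sym2.eq_iff] at h2
      rcases h2 with ⟨rfl, h2⟩ | ⟨rfl, -⟩
      · exact hw.2 (by simp)
      · have := hw.1
        rw [Walk.isPath_iff_nil, ← Walk.length_eq_zero_iff] at this
        rw [Walk.length_cons, this] at hl
        omega
    · exact hw.2 (Walk.snd_mem_support_of_mem_edges _ h2)

/-- Segments of a sequence of vertices. -/
theorem seg {f : ℕ → V} {c : ℕ} (hinj : Set.InjOn f (Set.Iio c))
    (hadj : ∀ i, i + 1 < c → G.Adj (f i) (f (i + 1))) (i j : ℕ) (hij : i ≤ j) (hj : j < c) :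
    Pth G ((Finset.Icc i j).image f) (f i) (f j) := by
  induction j, hij using Nat.le_induction with
  | base => simpa using Pth.nil _
  | succ j hij ih =>
    have := (ih (by omega)).join (Pth.nil (f (j + 1))) (hadj j hj) (by
      intro v hv hv2
      simp only [Finset.mem_image, Finset.mem_Icc, Finset.mem_singleton] at hv hv2
      obtain ⟨l, hl, rfl⟩ := hv
      have := hinj (show l ∈ Set.Iio c by simp; omega) (show j + 1 ∈ Set.Iio c by simpa) hv2
      omega)
    convert this using 1
    ext v
    simp only [Finset.mem_image, Finset.mem_Icc, Finset.mem_union, Finset.mem_singleton]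
    constructor
    · rintro ⟨l, hl, rfl⟩
      by_cases h : l = j + 1
      · right; rw [h]
      · left; exact ⟨l, by omega, rfl⟩
    · rintro (⟨l, hl, rfl⟩ | rfl)
      · exact ⟨l, by omega, rfl⟩
      · exact ⟨j + 1, by omega, rfl⟩

end Pth

/-- Linking lemma. -/
theorem link_set {V : Type*} [DecidableEq V] {G : SimpleGraph V}
    (d : V) (hconn : (G.induce ({d}ᶜ : Set V)).Connected) (X Y : V → Prop)
    (hX : ∃ x, x ≠ d ∧ X x) (hY : ∃ y, y ≠ d ∧ Y y) :
    ∃ K a b, Pth G K a b ∧ d ∉ K ∧ X a ∧ Y b ∧ (∀ v ∈ K, X v → v = a) ∧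
      (∀ v ∈ K, Y v → v = b) := by
  obtain ⟨x, hxd, hx⟩ := hX
  obtain ⟨y, hyd, hy⟩ := hY
  obtain ⟨w, hw⟩ := hconn.exists_isPath ⟨x, hxd⟩ ⟨y, hyd⟩
  have h1 := Pth.ofWalk _ (Walk.IsPath.map
    (f := (SimpleGraph.Embedding.induce ({d}ᶜ : Set V)).toHom)
    (SimpleGraph.Embedding.induce (G := G) ({d}ᶜ : Set V)).injective hw)
  have hd : d ∉ (w.map (SimpleGraph.Embedding.induce (G := G) ({d}ᶜ : Set V)).toHom).support.toFinset := by
    rw [List.mem_toFinset, Walk.support_map, List.mem_map]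
    rintro ⟨v, -, hv⟩
    exact v.2 hv
  generalize (w.map (SimpleGraph.Embedding.induce (G := G) ({d}ᶜ : Set V)).toHom).support.toFinset
    = K at h1 hd
  change Pth G K x y at h1
  obtain ⟨K₁, K₂, b, p1, -, hu, -, hb, hbu⟩ := h1.first Y ⟨y, h1.right_mem, hy⟩
  obtain ⟨K₃, K₄, a, p3, -, hu', -, ha, hau⟩ := p1.symm.first X ⟨x, p1.left_mem, hx⟩
  have hs : K₃ ⊆ K₁ := hu' ▸ Finset.subset_union_left
  refine ⟨K₃, a, b, p3.symm, ?_, ha, hb, hau, fun v hv => hbu v (hs hv)⟩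
  intro h
  exact hd (hu ▸ Finset.mem_union_left _ (hs h))

/-- Two disjoint paths from `D` to `C`, one of which starts in a prescribed vertex. -/
theorem two_links {V : Type*} [DecidableEq V] {G : SimpleGraph V}
    (hconn : ∀ d : V, (G.induce ({d}ᶜ : Set V)).Connected) (C : Finset V) (hC : 2 ≤ C.card)
    {R : Finset V} {d x : V} (p : Pth G R d x) :
    ∀ (D : Finset V), (∀ v ∈ R, v ∈ D → v = d) → d ∈ D → (∃ e ∈ D, e ≠ d) → x ∈ C →
      (∀ v ∈ R, v ∈ C → v = x) →
    ∃ A₁ A₂ e y₁ y₂, e ∈ D ∧ e ≠ d ∧ Pth G A₁ d y₁ ∧ Pth G A₂ e y₂ ∧ y₁ ∈ C ∧ y₂ ∈ C ∧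
      (∀ v ∈ A₁, v ∉ A₂) ∧ (∀ v ∈ A₁, v ∈ D → v = d) ∧ (∀ v ∈ A₂, v ∈ D → v = e) ∧
      (∀ v ∈ A₁, v ∈ C → v = y₁) ∧ (∀ v ∈ A₂, v ∈ C → v = y₂) := by
  induction p with
  | nil d =>
    intro D _ hdD ⟨e, heD, hed⟩ hdC _
    obtain ⟨y, hy, hyd⟩ := Finset.exists_mem_ne (by omega : 1 < C.card) d
    obtain ⟨K, a, b, p, hdK, ha, hb, hau, hbu⟩ := link_set d (hconn d)
      (fun v => v ∈ D) (fun v => v ∈ C) ⟨e, hed, heD⟩ ⟨y, hyd, hy⟩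
    refine ⟨{d}, K, a, d, b, ha, ?_, Pth.nil d, p, hdC, hb, ?_, by simp, hau, by simp, hbu⟩
    · rintro rfl; exact hdK p.left_mem
    · intro v hv; simp at hv; rwa [hv]
  | @cons R d e' x hadj hdR p ih =>
    intro D hRD hdD hex hxC hRC
    have hde' : e' ≠ d := hadj.ne'
    have hdC : d ∉ C := by
      intro h
      have := hRC d (by simp) h
      subst this
      exact hdR p.right_mem
    have hRD' : ∀ v ∈ R, v ∉ D := by
      intro v hv hvD
      have := hRD v (by simp [hv]) hvD
      subst this; exact hdR hv
    obtain ⟨A₁, A₂, f, y₁, y₂, hf, hfe', p1, p2, hy1, hy2, hdis, h1D, h2D, h1C, h2C⟩ :=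
      ih (insert e' D) (by
        intro v hv hvD
        rcases Finset.mem_insert.1 hvD with h | h
        · exact h
        · exact absurd h (hRD' v hv)) (by simp) ⟨d, by simp [hdD], hde'.symm⟩ hxC
        (fun v hv => hRC v (by simp [hv]))
    have hfD : f ∈ D := by
      rcases Finset.mem_insert.1 hf with h | h
      · exact absurd h hfe'
      · exact h
    have h1D' : ∀ v ∈ A₁, v ∉ D := by
      intro v hv hvD
      have := h1D v hv (by simp [hvD])
      subst this
      exact hRD' v p.left_mem hvD
    have h2D' : ∀ v ∈ A₂, v ∈ D → v = f := fun v hv hvD => h2D v hv (by simp [hvD])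
    have pd1 : Pth G (insert d A₁) d y₁ := Pth.cons hadj (fun h => h1D' d h hdD) p1
    have hd1D : ∀ v ∈ insert d A₁, v ∈ D → v = d := by
      intro v hv hvD
      rcases Finset.mem_insert.1 hv with h | h
      · exact h
      · exact absurd hvD (h1D' v h)
    have hd1C : ∀ v ∈ insert d A₁, v ∈ C → v = y₁ := by
      intro v hv hvC
      rcases Finset.mem_insert.1 hv with h | h
      · subst h; exact absurd hvC hdC
      · exact h1C v h hvC
    by_cases hfd : f = d
    · subst hfd
      obtain ⟨e, heD, hed⟩ := hex
      obtain ⟨B, b, q, pB, hfB, hb, hq, hbu, hqu⟩ := link_set f (hconn f)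
        (fun v => v ∈ D) (fun v => v ∈ A₁ ∨ v ∈ A₂ ∨ v ∈ C) ⟨e, hed, heD⟩
        ⟨e', hde', Or.inl p1.left_mem⟩
      have hbf : b ≠ f := by rintro rfl; exact hfB pB.left_mem
      by_cases hq1 : q ∈ A₁
      · obtain ⟨M₁, M₂, q', -, pM, hM, -, rfl, -⟩ := p1.first (fun v => v = q) ⟨q, hq1, rfl⟩
        have hM2 : ∀ v ∈ M₂, v ∈ A₁ := fun v hv => hM ▸ Finset.mem_union_right _ hv
        refine ⟨A₂, B ∪ M₂, b, y₂, y₁, hb, hbf, p2,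
          pB.trans pM (fun v hv hv2 => hqu v hv (Or.inl (hM2 v hv2))), hy2, hy1, ?_, h2D', ?_,
          h2C, ?_⟩
        · intro v hv hv2
          rcases Finset.mem_union.1 hv2 with h | h
          · have := hqu v h (Or.inr (Or.inl hv))
            subst this
            exact hdis v hq1 hv
          · exact hdis v (hM2 v h) hv
        · intro v hv hvD
          rcases Finset.mem_union.1 hv with h | h
          · exact hbu v h hvD
          · exact absurd hvD (h1D' v (hM2 v h))
        · intro v hv hvC
          rcases Finset.mem_union.1 hv with h | h
          · have := hqu v h (Or.inr (Or.inr hvC))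
            subst this
            exact h1C v hq1 hvC
          · exact h1C v (hM2 v h) hvC
      · by_cases hq2 : q ∈ A₂
        · obtain ⟨M₁, M₂, q', pM1, pM, hM, hMd, rfl, -⟩ :=
            p2.first (fun v => v = q) ⟨q, hq2, rfl⟩
          have hM2 : ∀ v ∈ M₂, v ∈ A₂ := fun v hv => hM ▸ Finset.mem_union_right _ hv
          have hfM : f ∉ M₂ := by
            intro h
            have := hMd f pM1.left_mem h
            subst this
            exact hfB pB.right_mem
          refine ⟨insert f A₁, B ∪ M₂, b, y₁, y₂, hb, hbf, pd1,
            pB.trans pM (fun v hv hv2 => hqu v hv (Or.inr (Or.inl (hM2 v hv2)))), hy1, hy2, ?_,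
            hd1D, ?_, hd1C, ?_⟩
          · intro v hv hv2
            rcases Finset.mem_insert.1 hv with rfl | hv
            · rcases Finset.mem_union.1 hv2 with h | h
              · exact hfB h
              · exact hfM h
            · rcases Finset.mem_union.1 hv2 with h | h
              · have := hqu v h (Or.inl hv)
                subst this
                exact hq1 hv
              · exact hdis v hv (hM2 v h)
          · intro v hv hvD
            rcases Finset.mem_union.1 hv with h | h
            · exact hbu v h hvD
            · have := h2D' v (hM2 v h) hvD
              subst this
              exact absurd h hfM
          · intro v hv hvC
            rcases Finset.mem_union.1 hv with h | h
            · have := hqu v h (Or.inr (Or.inr hvC))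
              subst this
              exact h2C v hq2 hvC
            · exact h2C v (hM2 v h) hvC
        · have hqC : q ∈ C := by tauto
          refine ⟨A₂, B, b, y₂, q, hb, hbf, p2, pB, hy2, hqC, ?_, h2D', hbu, h2C, ?_⟩
          · intro v hv hv2
            have := hqu v hv2 (Or.inr (Or.inl hv))
            subst this
            exact hq2 hv
          · intro v hv hvC
            exact hqu v hv (Or.inr (Or.inr hvC))
    · refine ⟨insert d A₁, A₂, f, y₁, y₂, hfD, hfd, pd1, p2, hy1, hy2, ?_, hd1D, h2D', hd1C, h2C⟩
      intro v hv hv2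
      rcases Finset.mem_insert.1 hv with rfl | hv
      · exact hfd (h2D' v hv2 hdD).symm
      · exact hdis v hv hv2

/-- The data of a longest cycle with vertex set `C` and length `c`. -/
structure LongCyc {V : Type*} [DecidableEq V] (G : SimpleGraph V) (C : Finset V) (c : ℕ) :
    Prop where
  conn : ∀ d : V, (G.induce ({d}ᶜ : Set V)).Connected
  c4 : 4 ≤ c
  card : C.card = c
  rot : ∀ x ∈ C, ∃ f : ℕ → V, f 0 = x ∧ Set.InjOn f (Set.Iio c) ∧
    (∀ v, v ∈ C ↔ ∃ i < c, f i = v) ∧ (∀ i, i + 1 < c → G.Adj (f i) (f (i + 1))) ∧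
    G.Adj (f (c - 1)) (f 0)
  max : ∀ K a b, Pth G K a b → G.Adj b a → 3 ≤ K.card → K.card ≤ c

namespace LongCyc

variable {V : Type*} [DecidableEq V] {G : SimpleGraph V} {C : Finset V} {c : ℕ}

theorem two_paths (H : LongCyc G C c) {K L : Finset V} {a b : V} (p : Pth G K a b)
    (q : Pth G L a b) (hab : a ≠ b) (h : ∀ v ∈ K, v ∈ L → v = a ∨ v = b) (hL : 3 ≤ L.card) :
    K.card + L.card ≤ c + 2 := by
  obtain ⟨a', ha', q'⟩ := q.uncons hab
  have hca := Finset.card_erase_of_mem q.left_mem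
  have hba' : b ≠ a' := by
    rintro rfl
    have : (L.erase a) = {b} := by
      generalize L.erase a = M at q'
      cases q' with
      | nil => rfl
      | cons h ha p => exact absurd p.right_mem ha
    rw [this] at hca
    simp at hca
    omega
  obtain ⟨b', hb', q''⟩ := q'.symm.uncons hba'
  have hcb := Finset.card_erase_of_mem q'.right_mem
  have hdis : ∀ v ∈ K, v ∉ (L.erase a).erase b := by
    intro v hv hv2
    simp only [Finset.mem_erase] at hv2
    have := h v hv hv2.2.2
    tauto
  have hcy := H.max _ _ _ (p.join q'' hb' hdis) ha'.symm
  rw [Finset.card_union_of_disjoint (Finset.disjoint_left.2 hdis)] at hcy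
  have hK : 2 ≤ K.card := by
    have : ({a, b} : Finset V) ⊆ K := by
      intro v hv
      simp at hv
      rcases hv with rfl | rfl
      · exact p.left_mem
      · exact p.right_mem
    have := Finset.card_le_card this
    rwa [Finset.card_pair hab] at this
  omega

theorem ear (H : LongCyc G C c) {f : ℕ → V} (hinj : Set.InjOn f (Set.Iio c))
    (hf : ∀ v, v ∈ C ↔ ∃ i < c, f i = v) (hadj : ∀ i, i + 1 < c → G.Adj (f i) (f (i + 1)))
    (hlast : G.Adj (f (c - 1)) (f 0)) {Q : Finset V} {s : ℕ} (hs0 : 0 < s) (hsc : s < c)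
    (p : Pth G Q (f 0) (f s)) (hQ : ∀ v ∈ Q, v ∈ C → v = f 0 ∨ v = f s) (hQ3 : 3 ≤ Q.card) :
    Q.card ≤ s + 1 ∧ Q.card + s ≤ c + 1 := by
  have hinj' : ∀ i j, i < c → j < c → f i = f j → i = j := fun i j hi hj h => hinj hi hj h
  have hne : f 0 ≠ f s := fun h => by have := hinj' 0 s (by omega) hsc h; omega
  have cardseg : ∀ i j, j < c → ((Finset.Icc i j).image f).card = j + 1 - i := by
    intro i j hj
    rw [Finset.card_image_of_injOn, Nat.card_Icc]
    intro u hu v hv huv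
    simp at hu hv
    exact hinj' u v (by omega) (by omega) huv
  have hsegC : ∀ i j, j < c → ∀ v ∈ (Finset.Icc i j).image f, v ∈ C := by
    intro i j hj v hv
    simp only [Finset.mem_image, Finset.mem_Icc] at hv
    obtain ⟨l, hl, rfl⟩ := hv
    exact (hf _).2 ⟨l, by omega, rfl⟩
  constructor
  · have p1 := Pth.seg hinj hadj s (c - 1) (by omega) (by omega)
    have hd : ∀ v ∈ (Finset.Icc s (c - 1)).image f, v ∉ ({f 0} : Finset V) := by
      intro v hv hv2
      simp only [Finset.mem_image, Finset.mem_Icc, Finset.mem_singleton] at hv hv2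
      obtain ⟨l, hl, rfl⟩ := hv
      have := hinj' l 0 (by omega) (by omega) hv2
      omega
    have p2 := (p1.join (Pth.nil (f 0)) hlast hd).symm
    have := H.two_paths p2 p hne (by
      intro v hv hvQ
      refine hQ v hvQ ?_
      rcases Finset.mem_union.1 hv with h | h
      · exact hsegC _ _ (by omega) v h
      · simp at h
        exact (hf _).2 ⟨0, by omega, h.symm⟩) hQ3
    rw [Finset.card_union_of_disjoint (Finset.disjoint_left.2 hd), cardseg _ _ (by omega)] at this
    simp at this
    omega
  · have p1 := Pth.seg hinj hadj 0 s (by omega) (by omega)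
    have := H.two_paths p1 p hne (fun v hv hvQ => hQ v hvQ (hsegC _ _ (by omega) v hv)) hQ3
    rw [cardseg _ _ (by omega)] at this
    omega

theorem card_gap (I : Finset ℕ) (a b : ℕ) (hab : a ≤ b) (hI : ∀ i ∈ I, a ≤ i ∧ i ≤ b)
    (hc : ∀ i ∈ I, i + 1 ∉ I) : 2 * I.card + a ≤ b + 2 := by
  have hd : Disjoint I (I.image (· + 1)) := by
    rw [Finset.disjoint_left]
    intro i hi hi2
    simp only [Finset.mem_image] at hi2
    obtain ⟨j, hj, rfl⟩ := hi2
    exact hc j hj hi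
  have hs : I ∪ I.image (· + 1) ⊆ Finset.Icc a (b + 1) := by
    intro i hi
    simp only [Finset.mem_union, Finset.mem_image, Finset.mem_Icc] at hi ⊢
    rcases hi with hi | ⟨j, hj, rfl⟩
    · have := hI i hi; omega
    · have := hI j hj; omega
  have := Finset.card_le_card hs
  rw [Finset.card_union_of_disjoint hd, Finset.card_image_of_injective _ (add_left_injective 1),
    Nat.card_Icc] at this
  omega

open Classical in
theorem case_one (H : LongCyc G C c) {K : Finset V} {x z : V} (hx : x ∈ C) (hz : z ∉ C)
    (p : Pth G K x z) (hK : ∀ v ∈ K, v ∈ C → v = x)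
    (hY : ((C.filter (fun y => G.Adj z y)).erase x).Nonempty) :
    2 * (((C.filter (fun y => G.Adj z y)).erase x).card + K.card) ≤ c + 2 := by
  obtain ⟨f, hf0, hinj, hf, hadj, hlast⟩ := H.rot x hx
  have hinj' : ∀ i j, i < c → j < c → f i = f j → i = j := fun i j hi hj h => hinj hi hj h
  set Y := (C.filter (fun y => G.Adj z y)).erase x with hYdef
  have hxz : x ≠ z := by rintro rfl; exact hz hx
  have hK2 : 2 ≤ K.card := by
    have : ({x, z} : Finset V) ⊆ K := by
      intro v hv
      simp at hv
      rcases hv with rfl | rfl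
      · exact p.left_mem
      · exact p.right_mem
    have := Finset.card_le_card this
    rwa [Finset.card_pair hxz] at this
  set I := (Finset.range c).filter (fun i => f i ∈ Y) with hI
  have hcard : Y.card = I.card := by
    have : Y = I.image f := by
      ext v
      simp only [hI, Finset.mem_image, Finset.mem_filter, Finset.mem_range]
      constructor
      · intro hv
        have hvC : v ∈ C := by simp [hYdef] at hv; tauto
        obtain ⟨i, hi, rfl⟩ := (hf v).1 hvC
        exact ⟨i, ⟨hi, hv⟩, rfl⟩
      · rintro ⟨i, ⟨_, hi⟩, rfl⟩
        exact hi
    rw [this, Finset.card_image_of_injOn]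
    intro u hu v hv huv
    simp [hI] at hu hv
    exact hinj' u v (by omega) (by omega) huv
  have hIb : ∀ i ∈ I, K.card ≤ i ∧ i ≤ c - K.card ∧ K.card + i ≤ c := by
    intro i hi
    simp only [hI, Finset.mem_filter, Finset.mem_range, hYdef, Finset.mem_erase] at hi
    obtain ⟨hic, hix, hiC, hza⟩ := hi
    have hi0 : 0 < i := by
      rcases Nat.eq_zero_or_pos i with rfl | h
      · exact absurd hf0 hix
      · exact h
    have hd : ∀ v ∈ K, v ∉ ({f i} : Finset V) := by
      intro v hv hv2
      simp at hv2
      subst hv2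
      exact hix (hK _ hv hiC)
    have p1 := p.join (Pth.nil (f i)) hza hd
    have hc1 : (K ∪ {f i}).card = K.card + 1 := by
      rw [Finset.card_union_of_disjoint (Finset.disjoint_left.2 hd)]; simp
    rw [← hf0] at p1
    have := H.ear hinj hf hadj hlast hi0 hic p1 (by
      intro v hv hvC
      rcases Finset.mem_union.1 hv with h | h
      · left; rw [hf0]; exact hK v h hvC
      · right; simpa using h) (by omega)
    omega
  obtain ⟨y, hy⟩ := hY
  have hIne : 0 < I.card := by
    rw [← hcard]; exact Finset.card_pos.2 ⟨y, hy⟩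
  obtain ⟨i0, hi0⟩ := Finset.card_pos.1 hIne
  have h0 := hIb i0 hi0
  have := card_gap I K.card (c - K.card) (by omega) (fun i hi => ⟨(hIb i hi).1, (hIb i hi).2.1⟩) (by
    intro i hi hi1
    have hb := hIb i hi
    have hb1 := hIb _ hi1
    simp only [hI, Finset.mem_filter, Finset.mem_range, hYdef, Finset.mem_erase] at hi hi1
    have hA := Pth.seg hinj hadj (i + 1) (c - 1) (by omega) (by omega)
    have hB := Pth.seg hinj hadj 0 i (by omega) (by omega)
    have hd : ∀ v ∈ (Finset.Icc (i + 1) (c - 1)).image f, v ∉ (Finset.Icc 0 i).image f := by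
      intro v hv hv2
      simp only [Finset.mem_image, Finset.mem_Icc] at hv hv2
      obtain ⟨l, hl, rfl⟩ := hv
      obtain ⟨m, hm, hml⟩ := hv2
      have := hinj' m l (by omega) (by omega) hml
      omega
    have hAB := hA.join hB hlast hd
    have hsub : (Finset.Icc (i + 1) (c - 1)).image f ∪ (Finset.Icc 0 i).image f = C := by
      ext v
      rw [hf v]
      simp only [Finset.mem_image, Finset.mem_Icc, Finset.mem_union]
      constructor
      · rintro (⟨l, hl, rfl⟩ | ⟨l, hl, rfl⟩) <;> exact ⟨l, by omega, rfl⟩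
      · rintro ⟨l, hl, rfl⟩
        by_cases h : l ≤ i
        · right; exact ⟨l, by omega, rfl⟩
        · left; exact ⟨l, by omega, rfl⟩
    rw [hsub] at hAB
    have hd2 : ∀ v ∈ C, v ∉ ({z} : Finset V) := by
      intro v hv hv2
      simp at hv2; subst hv2; exact hz hv
    have hcy := H.max _ _ _ (hAB.join (Pth.nil z) hi.2.2.2.symm hd2) hi1.2.2.2
    rw [Finset.card_union_of_disjoint (Finset.disjoint_left.2 hd2), H.card] at hcy
    simp at hcy
    have := H.c4
    omega)
  rw [hcard]
  omega

open Classical in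
theorem case_two (H : LongCyc G C c) {K : Finset V} {x z : V} (hx : x ∈ C) (hz : z ∉ C)
    (p : Pth G K x z) (hK : ∀ v ∈ K, v ∈ C → v = x)
    (hN : (K.filter (fun y => G.Adj z y)).Nonempty) :
    2 * ((K.filter (fun y => G.Adj z y)).card + 1) ≤ c := by
  obtain ⟨y, hy⟩ := hN
  rw [Finset.mem_filter] at hy
  obtain ⟨K₁, K₂, q, p1, p2, hu, hd, hzq, hfirst⟩ := p.first (fun v => G.Adj z v) ⟨y, hy⟩
  have hK2 : ∀ v ∈ K₂, v ∈ K := fun v hv => hu ▸ Finset.mem_union_right _ hv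
  have hK1 : ∀ v ∈ K₁, v ∈ K := fun v hv => hu ▸ Finset.mem_union_left _ hv
  have hNK2 : ∀ v ∈ K, G.Adj z v → v ∈ K₂ := by
    intro v hv hzv
    rw [← hu] at hv
    rcases Finset.mem_union.1 hv with h | h
    · rw [hfirst v h hzv]; exact p2.left_mem
    · exact h
  obtain ⟨A₁, A₂, e, y₁, y₂, heK, heq, pA1, pA2, hy1, hy2, hdis, h1D, h2D, h1C, h2C⟩ :=
    two_links H.conn C (by have := H.c4; have := H.card; omega) p1.symm K₂ hd p2.left_mem
      ⟨z, p2.right_mem, hzq.ne⟩ hx (fun v hv => hK v (hK1 v hv))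
  obtain ⟨M, L, e', pM, pL, -, hML, hMLd⟩ := p2.split heK (Ne.symm heq)
  obtain ⟨M₁, M₂, j, -, pj, hMu, -, hzj, hjf⟩ :=
    pM.symm.first (fun v => G.Adj z v) ⟨q, pM.left_mem, hzq⟩
  have hM2M : ∀ v ∈ M₂, v ∈ M := fun v hv => hMu ▸ Finset.mem_union_right _ hv
  have hMK : ∀ v ∈ M, v ∈ K₂ := fun v hv => hML ▸ Finset.mem_union_left _ hv
  have hLK : ∀ v ∈ L, v ∈ K₂ := fun v hv => hML ▸ Finset.mem_union_right _ hv
  have pmid := pj.symm.join pL.symm hzj.symm (fun v hv => hMLd v (hM2M v hv))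
  have hmidK : ∀ v ∈ M₂ ∪ L, v ∈ K₂ := by
    intro v hv
    rcases Finset.mem_union.1 hv with h | h
    · exact hMK v (hM2M v h)
    · exact hLK v h
  have hmidN : ∀ v ∈ K, G.Adj z v → v ∈ M₂ ∪ L := by
    intro v hv hzv
    have h2 := hNK2 v hv hzv
    rw [← hML] at h2
    rcases Finset.mem_union.1 h2 with h | h
    · rw [← hMu] at h
      rcases Finset.mem_union.1 h with h | h
      · rw [hjf v h hzv]; exact Finset.mem_union_left _ pj.left_mem
      · exact Finset.mem_union_left _ h
    · exact Finset.mem_union_right _ h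
  have pQ1 := pA1.symm.trans pmid (fun v hv hv2 => h1D v hv (hmidK v hv2))
  have pQ := pQ1.trans pA2 (by
    intro v hv hv2
    rcases Finset.mem_union.1 hv with h | h
    · exact absurd hv2 (hdis v h)
    · exact h2D v hv2 (hmidK v h))
  set Q := A₁ ∪ (M₂ ∪ L) ∪ A₂ with hQ
  have hy12 : y₁ ≠ y₂ := by
    rintro rfl
    exact hdis _ pA1.right_mem pA2.right_mem
  have hxy : ∀ v ∈ K₂, v ∈ C → v = y₁ := by
    intro v hv hvC
    have h1 := hK v (hK2 v hv) hvC
    subst h1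
    have h2 := hd v p1.left_mem hv
    subst h2
    exact h1C v pA1.left_mem hvC
  have hQC : ∀ v ∈ Q, v ∈ C → v = y₁ ∨ v = y₂ := by
    intro v hv hvC
    rcases Finset.mem_union.1 hv with h | h
    · rcases Finset.mem_union.1 h with h | h
      · exact Or.inl (h1C v h hvC)
      · exact Or.inl (hxy v (hmidK v h) hvC)
    · exact Or.inr (h2C v h hvC)
  have hsub : insert y₂ (insert z (K.filter (fun y => G.Adj z y))) ⊆ Q := by
    intro v hv
    simp only [Finset.mem_insert, Finset.mem_filter] at hv
    rcases hv with rfl | rfl | ⟨h, h'⟩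
    · exact pQ.right_mem
    · simp only [hQ, Finset.mem_union]
      exact Or.inl (Or.inr (Or.inr pL.right_mem))
    · have := hmidN v h h'
      simp only [hQ, Finset.mem_union] at this ⊢
      tauto
  have hQcard := Finset.card_le_card hsub
  rw [Finset.card_insert_of_notMem, Finset.card_insert_of_notMem (by simp)] at hQcard
  swap
  · simp only [Finset.mem_insert, Finset.mem_filter, not_or]
    refine ⟨by rintro rfl; exact hz hy2, ?_⟩
    rintro ⟨h, h'⟩
    exact hy12 (hxy _ (hNK2 _ h h') hy2).symm
  have hNpos : 0 < (K.filter (fun y => G.Adj z y)).card :=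
    Finset.card_pos.2 ⟨y, Finset.mem_filter.2 hy⟩
  obtain ⟨f, hf0, hinj, hf, hadj, hlast⟩ := H.rot y₁ hy1
  obtain ⟨s, hs, rfl⟩ := (hf y₂).1 hy2
  subst hf0
  have hs0 : 0 < s := by
    rcases Nat.eq_zero_or_pos s with rfl | h
    · exact absurd rfl hy12
    · exact h
  have := H.ear hinj hf hadj hlast hs0 hs pQ hQC (by omega)
  omega

open Classical in
/-- The end vertex of a maximal path. -/
theorem max_end (H : LongCyc G C c) {K S : Finset V} {x z : V} (hx : x ∈ C)
    (hSC : ∀ v ∈ S, v ∉ C)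
    (p : Pth G K x z) (hK : ∀ v ∈ K, v ∈ C → v = x) (hzS : z ∈ S)
    (hext : ∀ u ∈ S, G.Adj z u → u ∈ K)
    (hdeg : c / 2 ≤ (S.filter (fun y => G.Adj z y)).card + (C.filter (fun y => G.Adj z y)).card) :
    G.Adj z x ∧ (∀ v ∈ K, v ≠ x → v ∈ S ∧ (v ≠ z → G.Adj z v)) ∧
      (C.filter (fun y => G.Adj z y)).card + K.card = c / 2 + 2 := by
  have hz := hSC z hzS
  have hxz : x ≠ z := by rintro rfl; exact hz hx
  have hc4 := H.c4
  have hNS : S.filter (fun y => G.Adj z y) ⊆ (K.erase x).erase z := by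
    intro v hv
    rw [Finset.mem_filter] at hv
    simp only [Finset.mem_erase]
    exact ⟨hv.2.ne', by rintro rfl; exact hSC _ hv.1 hx, hext v hv.1 hv.2⟩
  have hcardK : ((K.erase x).erase z).card = K.card - 1 - 1 := by
    rw [Finset.card_erase_of_mem (by simp [hxz.symm, p.right_mem]),
      Finset.card_erase_of_mem p.left_mem]
  have hle := Finset.card_le_card hNS
  have hK2 : 2 ≤ K.card := by
    have : ({x, z} : Finset V) ⊆ K := by
      intro v hv
      simp at hv
      rcases hv with rfl | rfl
      · exact p.left_mem
      · exact p.right_mem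
    have := Finset.card_le_card this
    rwa [Finset.card_pair hxz] at this
  by_cases hY : ((C.filter (fun y => G.Adj z y)).erase x).Nonempty
  · have h1 := H.case_one hx hz p hK hY
    have hxY : x ∈ C.filter (fun y => G.Adj z y) := by
      by_contra h
      rw [Finset.erase_eq_of_notMem h] at h1
      omega
    rw [Finset.card_erase_of_mem hxY] at h1
    have hpos : 0 < (C.filter (fun y => G.Adj z y)).card := Finset.card_pos.2 ⟨x, hxY⟩
    have heq : S.filter (fun y => G.Adj z y) = (K.erase x).erase z :=
      Finset.eq_of_subset_of_card_le hNS (by omega)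
    refine ⟨(Finset.mem_filter.1 hxY).2, ?_, by omega⟩
    intro v hv hvx
    by_cases hvz : v = z
    · subst hvz; exact ⟨hzS, fun h => absurd rfl h⟩
    · have : v ∈ S.filter (fun y => G.Adj z y) := by
        rw [heq]; simp [hv, hvx, hvz]
      rw [Finset.mem_filter] at this
      exact ⟨this.1, fun _ => this.2⟩
  · exfalso
    rw [Finset.not_nonempty_iff_eq_empty] at hY
    have hsub : S.filter (fun y => G.Adj z y) ∪ C.filter (fun y => G.Adj z y)
        ⊆ K.filter (fun y => G.Adj z y) := by
      intro v hv
      simp only [Finset.mem_union, Finset.mem_filter] at hv ⊢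
      rcases hv with hv | hv
      · exact ⟨hext v hv.1 hv.2, hv.2⟩
      · by_cases hvx : v = x
        · subst hvx; exact ⟨p.left_mem, hv.2⟩
        · have : v ∈ (C.filter (fun y => G.Adj z y)).erase x := by simp [hvx, hv]
          rw [hY] at this
          simp at this
    have hcard := Finset.card_le_card hsub
    rw [Finset.card_union_of_disjoint] at hcard
    · have := H.case_two hx hz p hK (Finset.card_pos.1 (by omega))
      omega
    · rw [Finset.disjoint_left]
      intro v hv hv2
      simp only [Finset.mem_filter] at hv hv2
      exact hSC v hv.1 hv2.1

open Classical in
theorem exists_clique [Fintype V] (H : LongCyc G C c) (S : Finset V) (hS : S.Nonempty)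
    (hSC : ∀ v ∈ S, v ∉ C)
    (hdeg : ∀ z ∈ S, c / 2 ≤
      (S.filter (fun y => G.Adj z y)).card + (C.filter (fun y => G.Adj z y)).card) :
    ∃ L ⊆ S, L.Nonempty ∧ ∀ u ∈ L, (∀ v ∈ S, G.Adj u v → v ∈ L) ∧
      (C.filter (fun y => G.Adj u y)).card + L.card = c / 2 + 1 := by
  set F : Finset (Finset V) := Finset.univ.filter (fun K => ∃ x z, x ∈ C ∧ z ∈ S ∧
    Pth G K x z ∧ ∀ v ∈ K, v ∈ C → v = x) with hF
  have hFne : F.Nonempty := by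
    obtain ⟨u, hu⟩ := hS
    have h4 := H.c4
    have hc := H.card
    obtain ⟨d, hd⟩ : C.Nonempty := Finset.card_pos.1 (by omega)
    obtain ⟨y, hy, hyd⟩ := Finset.exists_mem_ne (by omega : 1 < C.card) d
    have hud : u ≠ d := by rintro rfl; exact hSC _ hu hd
    obtain ⟨K, a, b, p, hdK, ha, hb, hau, -⟩ := link_set d (H.conn d)
      (fun v => v ∈ C) (fun v => v = u) ⟨y, hyd, hy⟩ ⟨u, hud, rfl⟩
    subst hb
    exact ⟨K, by simp only [hF, Finset.mem_filter, Finset.mem_univ, true_and]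
                 exact ⟨a, b, ha, hu, p, hau⟩⟩
  obtain ⟨K, hKF, hKmax⟩ := Finset.exists_max_image F Finset.card hFne
  simp only [hF, Finset.mem_filter, Finset.mem_univ, true_and] at hKF hKmax
  obtain ⟨x, z, hx, hz, p, hKC⟩ := hKF
  have key : ∀ z, z ∈ S → Pth G K x z → (∀ u ∈ S, G.Adj z u → u ∈ K) ∧
      G.Adj z x ∧ (∀ v ∈ K, v ≠ x → v ∈ S ∧ (v ≠ z → G.Adj z v)) ∧
      (C.filter (fun y => G.Adj z y)).card + K.card = c / 2 + 2 := by
    intro z hz p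
    have hext : ∀ u ∈ S, G.Adj z u → u ∈ K := by
      intro u hu hzu
      by_contra huK
      have hd : ∀ v ∈ K, v ∉ ({u} : Finset V) := by
        intro v hv hv2
        simp at hv2; subst hv2; exact huK hv
      have := hKmax (K ∪ {u}) ⟨x, u, hx, hu, p.join (Pth.nil u) hzu hd, by
        intro v hv hvC
        rcases Finset.mem_union.1 hv with h | h
        · exact hKC v h hvC
        · simp at h; subst h; exact absurd hvC (hSC _ hu)⟩
      rw [Finset.card_union_of_disjoint (Finset.disjoint_left.2 hd)] at this
      simp at this
    exact ⟨hext, H.max_end hx hSC p hKC hz hext (hdeg z hz)⟩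
  obtain ⟨-, hzx, hzK, -⟩ := key z hz p
  have hzx' : z ≠ x := hzx.ne
  have hcard := Finset.card_erase_of_mem p.left_mem
  have hpos : 0 < K.card := Finset.card_pos.2 ⟨x, p.left_mem⟩
  refine ⟨K.erase x, ?_, ⟨z, by simp [hzx', p.right_mem]⟩, ?_⟩
  · intro v hv
    rw [Finset.mem_erase] at hv
    exact (hzK v hv.2 hv.1).1
  · intro u hu
    rw [Finset.mem_erase] at hu
    obtain ⟨K₁, K₂, u', p1, p2, -, hun, hdis⟩ := p.split hu.2 (Ne.symm hu.1)
    have hu'z : G.Adj u' z := by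
      by_cases h : u' = x
      · subst h; exact hzx.symm
      · refine ((hzK u' (hun ▸ Finset.mem_union_left _ p1.right_mem) h).2 ?_).symm
        rintro rfl
        exact hdis _ p1.right_mem p2.right_mem
    have pu := p1.join p2.symm hu'z hdis
    rw [hun] at pu
    obtain ⟨h1, h2, h3, h4⟩ := key u (hzK u hu.2 hu.1).1 pu
    refine ⟨?_, by omega⟩
    intro v hv huv
    rw [Finset.mem_erase]
    exact ⟨by rintro rfl; exact hSC _ hv hx, h1 v hv huv⟩

end LongCyc

theorem edgesWithin_insert {V : Type*} [Fintype V] [DecidableEq V] (G : SimpleGraph V)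
    [DecidableRel G.Adj] (T : Finset V) (u : V) :
    edgesWithin G (↑(insert u T)) ≤ edgesWithin G ↑T + (T.filter (fun y => G.Adj u y)).card := by
  unfold edgesWithin
  have hsub : {e ∈ G.edgeSet | ∀ x ∈ e, x ∈ (↑(insert u T) : Set V)} ⊆
      {e ∈ G.edgeSet | ∀ x ∈ e, x ∈ (↑T : Set V)} ∪
        ↑((T.filter (fun y => G.Adj u y)).image (fun y => s(u, y))) := by
    intro e
    induction e using Sym2.ind with
    | _ a b =>
      rintro ⟨he, h⟩
      rw [SimpleGraph.mem_edgeSet] at he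
      have ha := h a (by simp)
      have hb := h b (by simp)
      simp only [Finset.coe_insert, Set.mem_insert_iff, Finset.mem_coe] at ha hb
      by_cases hau : a = u
      · subst hau
        right
        have : b ∈ T := by
          rcases hb with hb | hb
          · exact absurd hb he.ne'
          · exact hb
        simp only [Finset.coe_image, Set.mem_image, Finset.mem_coe, Finset.mem_filter]
        exact ⟨b, ⟨this, he⟩, rfl⟩
      · have haT : a ∈ T := by tauto
        by_cases hbu : b = u
        · subst hbu
          right
          simp only [Finset.coe_image, Set.mem_image, Finset.mem_coe, Finset.mem_filter]
          exact ⟨a, ⟨haT, he.symm⟩, Sym2.eq_swap⟩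
        · left
          refine ⟨he, ?_⟩
          intro x hx
          rw [Sym2.mem_iff] at hx
          rcases hx with rfl | rfl
          · exact haT
          · simp; tauto
  refine (Set.ncard_le_ncard hsub (Set.toFinite _)).trans ((Set.ncard_union_le _ _).trans ?_)
  rw [Set.ncard_coe_finset]
  exact Nat.add_le_add_left Finset.card_image_le _

open Classical in
theorem clique_bound {V : Type*} [Fintype V] (G : SimpleGraph V)
    (C T L : Finset V) (r : ℕ) (hr : ∀ u ∈ L, (C.filter (fun y => G.Adj u y)).card = r)
    (hT : ∀ u ∈ L, ∀ v ∈ T, ¬ G.Adj u v) :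
    2 * edgesWithin G (↑(C ∪ T ∪ L)) + L.card ≤
      2 * edgesWithin G (↑(C ∪ T)) + 2 * r * L.card + L.card * L.card := by
  induction L using Finset.induction_on with
  | empty => simp
  | @insert u L hu ih =>
    have ih' := ih (fun v hv => hr v (by simp [hv])) (fun v hv => hT v (by simp [hv]))
    have h1 := edgesWithin_insert G (C ∪ T ∪ L) u
    have h2 : ((C ∪ T ∪ L).filter (fun y => G.Adj u y)).card ≤ r + L.card := by
      have : (C ∪ T ∪ L).filter (fun y => G.Adj u y) ⊆ C.filter (fun y => G.Adj u y) ∪ L := by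
        intro v hv
        simp only [Finset.mem_filter, Finset.mem_union] at hv ⊢
        have := hT u (by simp) v
        tauto
      refine (Finset.card_le_card this).trans ((Finset.card_union_le _ _).trans ?_)
      rw [hr u (by simp)]
    rw [Finset.union_insert, Finset.card_insert_of_notMem hu]
    nlinarith

open Classical in
theorem LongCyc.bound {V : Type*} [Fintype V] {G : SimpleGraph V} {C : Finset V} {c : ℕ}
    (H : LongCyc G C c) (S : Finset V) : (∀ v ∈ S, v ∉ C) →
    2 * edgesWithin G (↑(C ∪ S)) ≤ 2 * edgesWithin G (↑C) +
      ∑ u ∈ S, (if (C.filter (fun y => G.Adj u y)).card = c / 2 then 2 * (c / 2)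
        else 2 * (c / 2) - 1) := by
  have hc4 := H.c4
  induction S using Finset.strongInduction with
  | H S ih =>
    intro hSC
    rcases S.eq_empty_or_nonempty with rfl | hS
    · simp
    by_cases hdeg : ∀ z ∈ S, c / 2 ≤
      (S.filter (fun y => G.Adj z y)).card + (C.filter (fun y => G.Adj z y)).card
    · obtain ⟨L, hLS, hLne, hL⟩ := H.exists_clique S hS hSC hdeg
      have hss : S \ L ⊂ S := Finset.sdiff_ssubset hLS hLne
      have ih' := ih _ hss (fun v hv => hSC v (hss.1 hv))
      have hcl := clique_bound G C (S \ L) L (c / 2 + 1 - L.card)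
        (fun u hu => by have := (hL u hu).2; omega) (by
          intro u hu v hv huv
          rw [Finset.mem_sdiff] at hv
          exact hv.2 ((hL u hu).1 v hv.1 huv))
      rw [Finset.union_assoc, Finset.sdiff_union_of_subset hLS] at hcl
      rw [← Finset.sum_sdiff hLS]
      obtain ⟨u, hu⟩ := hLne
      have hpos : 0 < L.card := Finset.card_pos.2 ⟨u, hu⟩
      have hle : L.card ≤ c / 2 + 1 := by have := (hL u hu).2; omega
      obtain ⟨r, hr⟩ := Nat.exists_eq_add_of_le hle
      have hr' : c / 2 + 1 - L.card = r := by omega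
      rw [hr'] at hcl
      by_cases h1 : L.card = 1
      · have : ∑ u ∈ L, (if (C.filter (fun y => G.Adj u y)).card = c / 2 then 2 * (c / 2)
          else 2 * (c / 2) - 1) = 2 * (c / 2) := by
          obtain ⟨a, rfl⟩ := Finset.card_eq_one.1 h1
          rw [Finset.sum_singleton, if_pos]
          have := (hL a (by simp)).2
          omega
        rw [this]
        rw [h1] at hcl
        omega
      · have : ∑ u ∈ L, (if (C.filter (fun y => G.Adj u y)).card = c / 2 then 2 * (c / 2)
          else 2 * (c / 2) - 1) = L.card * (2 * (c / 2) - 1) := by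
          rw [Finset.sum_const_nat]
          intro a ha
          rw [if_neg]
          have := (hL a ha).2
          omega
        rw [this]
        have h2 : 2 * (c / 2) - 1 = 2 * r + 2 * L.card - 3 := by omega
        obtain ⟨l, hl⟩ : ∃ l, L.card = l + 2 := ⟨L.card - 2, by omega⟩
        rw [hl] at hcl
        have h3 : 2 * r + 2 * (l + 2) - 3 = 2 * r + 2 * l + 1 := by omega
        have h4 : L.card * (2 * (c / 2) - 1) = (l + 2) * (2 * r + 2 * l + 1) := by
          rw [h2, hl, h3]
        rw [h4]
        nlinarith
    · push Not at hdeg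
      obtain ⟨z, hz, hdz⟩ := hdeg
      have hss : S.erase z ⊂ S := Finset.erase_ssubset hz
      have ih' := ih _ hss (fun v hv => hSC v (hss.1 hv))
      have h1 := edgesWithin_insert G (C ∪ S.erase z) z
      rw [← Finset.union_insert, Finset.insert_erase hz] at h1
      have h2 : ((C ∪ S.erase z).filter (fun y => G.Adj z y)).card ≤
          (S.filter (fun y => G.Adj z y)).card + (C.filter (fun y => G.Adj z y)).card := by
        refine le_trans (Finset.card_le_card (t := S.filter (fun y => G.Adj z y) ∪
          C.filter (fun y => G.Adj z y)) ?_) (Finset.card_union_le _ _)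
        intro v hv
        simp only [Finset.mem_filter, Finset.mem_union, Finset.mem_erase] at hv ⊢
        tauto
      rw [← Finset.add_sum_erase _ _ hz]
      split_ifs <;> omega

theorem longCyc_of_walk {V : Type*} [Fintype V] [DecidableEq V] (k : ℕ) (hk : 5 ≤ k)
    (G : SimpleGraph V) (hG2 : TwoConnected G)
    (v : V) (w : G.Walk v v) (hw : w.IsCycle) (hlen : w.length = k - 1)
    (hlongest : ∀ (x : V) (w' : G.Walk x x), w'.IsCycle → w'.length ≤ k - 1) :
    LongCyc G w.support.toFinset (k - 1) := by
  have hrot : ∀ x ∈ w.support.toFinset, ∃ f : ℕ → V, f 0 = x ∧ Set.InjOn f (Set.Iio (k - 1)) ∧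
    (∀ v, v ∈ w.support.toFinset ↔ ∃ i < k - 1, f i = v) ∧
    (∀ i, i + 1 < k - 1 → G.Adj (f i) (f (i + 1))) ∧
    G.Adj (f (k - 1 - 1)) (f 0) := by
    intro x hx
    rw [List.mem_toFinset] at hx
    have hc := hw.rotate hx
    have hl : (w.rotate x hx).length = k - 1 := by rw [Walk.length_rotate, hlen]
    have hlast : (w.rotate x hx).getVert (k - 1) = x := by
      rw [← hl]; exact Walk.getVert_length _
    refine ⟨(w.rotate x hx).getVert, Walk.getVert_zero _, ?_, ?_, ?_, ?_⟩
    · intro i hi j hj hij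
      exact hc.getVert_injOn' (by simp at hi ⊢; omega) (by simp at hj ⊢; omega) hij
    · intro u
      rw [List.mem_toFinset, ← Walk.mem_support_rotate_iff w x hx, Walk.mem_support_iff_exists_getVert]
      constructor
      · rintro ⟨i, hi, hil⟩
        by_cases h : i = k - 1
        · exact ⟨0, by omega, by rw [Walk.getVert_zero, ← hi, h, hlast]⟩
        · exact ⟨i, by omega, hi⟩
      · rintro ⟨i, hi, hil⟩
        exact ⟨i, hil, by omega⟩
    · intro i hi
      exact Walk.adj_getVert_succ _ (by omega)
    · have := Walk.adj_getVert_succ (w.rotate x hx) (i := k - 1 - 1) (by omega)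
      rw [show k - 1 - 1 + 1 = k - 1 by omega, hlast] at this
      rwa [Walk.getVert_zero]
  refine ⟨hG2.2.2, by omega, ?_, hrot, ?_⟩
  · obtain ⟨f, -, hinj, hf, -⟩ := hrot v (by simp)
    have : w.support.toFinset = (Finset.range (k - 1)).image f := by
      ext u
      rw [hf u]; simp
    rw [this, Finset.card_image_of_injOn (by simpa using hinj), Finset.card_range]
  · intro K a b p h h3
    obtain ⟨w', hw', hl'⟩ := p.exists_cycle h h3
    exact hl' ▸ hlongest _ w' hw'

/-- Edge bound when the longest cycle has length `c = k−1`: for `k ≥ 5`,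
`t = ⌊(k-1)/2⌋`, a 2-connected `𝓒_{≥k}`-free graph `G` with longest cycle `C`
of length `k−1 ≤ n−1` satisfies
`e(G) ≤ e(G[C]) + t·m + (t − 1/2)(n − c − m)`, where `m = |A_{⌊c/2⌋}|`. -/
theorem stmt10 {V : Type*} [Fintype V] (k : ℕ) (hk : 5 ≤ k)
    (G : SimpleGraph V) (hG2 : TwoConnected G) (hGk : ¬ HasCycleGE G k)
    (v : V) (w : G.Walk v v) (hw : w.IsCycle) (hlen : w.length = k - 1)
    (hlongest : ∀ (x : V) (w' : G.Walk x x), w'.IsCycle → w'.length ≤ k - 1)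
    (hcn : k - 1 + 1 ≤ Fintype.card V) :
    (edgeCount G : ℝ)
      ≤ (edgesWithin G {x | x ∈ w.support} : ℝ)
        + (↑((k - 1) / 2) : ℝ)
          * (↑({u | u ∉ w.support ∧
              degOn G {x | x ∈ w.support} u = (k - 1) / 2}.ncard) : ℝ)
        + ((↑((k - 1) / 2) : ℝ) - 1 / 2)
          * ((Fintype.card V : ℝ) - ((k : ℝ) - 1)
            - (↑({u | u ∉ w.support ∧
                degOn G {x | x ∈ w.support} u = (k - 1) / 2}.ncard) : ℝ)) := by
  classical
  have H := longCyc_of_walk k hk G hG2 v w hw hlen hlongest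
  set C := w.support.toFinset with hC
  have hCs : {x | x ∈ w.support} = (↑C : Set V) := by
    ext x; simp [hC]
  have hb := H.bound (Finset.univ \ C) (by simp)
  have hall : edgesWithin G (↑(C ∪ (Finset.univ \ C))) = edgeCount G := by
    rw [Finset.union_sdiff_of_subset (Finset.subset_univ C)]
    simp [edgesWithin, edgeCount]
  rw [hall] at hb
  have hdeg : ∀ u, degOn G (↑C : Set V) u = (C.filter (fun y => G.Adj u y)).card := by
    intro u
    unfold degOn
    rw [← Set.ncard_coe_finset]
    congr 1
    ext y; simp
  rw [hCs]
  have hm : {u | u ∉ w.support ∧ degOn G (↑C : Set V) u = (k - 1) / 2}.ncard =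
      ((Finset.univ \ C).filter
        (fun u => (C.filter (fun y => G.Adj u y)).card = (k - 1) / 2)).card := by
    rw [← Set.ncard_coe_finset]
    congr 1
    ext u
    rw [Set.mem_ofPred_eq, hdeg]
    simp only [Finset.coe_filter, Finset.mem_sdiff, Finset.mem_univ, true_and, Set.mem_ofPred_eq,
      hC, List.mem_toFinset]
  rw [hm]
  set M := (Finset.univ \ C).filter
        (fun u => (C.filter (fun y => G.Adj u y)).card = (k - 1) / 2) with hM
  have hsum : ∑ u ∈ Finset.univ \ C, (if (C.filter (fun y => G.Adj u y)).card = (k - 1) / 2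
      then 2 * ((k - 1) / 2) else 2 * ((k - 1) / 2) - 1) =
      (2 * ((k - 1) / 2) - 1) * (Finset.univ \ C).card + M.card := by
    rw [hM, Finset.card_filter, mul_comm (2 * ((k - 1) / 2) - 1) (Finset.univ \ C).card,
      ← smul_eq_mul (Finset.univ \ C).card, ← Finset.sum_const, ← Finset.sum_add_distrib]
    refine Finset.sum_congr rfl fun u _ => ?_
    split_ifs <;> omega
  rw [hsum] at hb
  have hcard : (Finset.univ \ C).card + (k - 1) = Fintype.card V := by
    rw [← H.card, Finset.card_sdiff_add_card_eq_card (Finset.subset_univ C), Finset.card_univ]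
  have hcardR : ((Finset.univ \ C).card : ℝ) = (Fintype.card V : ℝ) - ((k : ℝ) - 1) := by
    rw [← hcard]; push_cast [Nat.cast_sub (by omega : 1 ≤ k)]; ring
  rw [← hcardR]
  have hbR : (2 : ℝ) * (edgeCount G : ℝ) ≤ 2 * (edgesWithin G (↑C : Set V) : ℝ) +
      ((2 * (((k - 1) / 2 : ℕ) : ℝ) - 1) * ((Finset.univ \ C).card : ℝ) + (M.card : ℝ)) := by
    have h1 : 1 ≤ 2 * ((k - 1) / 2) := by omega
    have := (Nat.cast_le (α := ℝ)).2 hb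
    rw [Nat.cast_mul, Nat.cast_add, Nat.cast_mul, Nat.cast_add, Nat.cast_mul, Nat.cast_sub h1,
      Nat.cast_mul] at this
    simpa using this
  linarith
end

section
/- Let k ≥ 6 be even and t = (k-2)/2. Let G be a 2-connected graph on n vertices containing no cycle of length ≥ k, and let C be a longest cycle of G of length c = k−2, with c ≤ n−1. Set m = |A_{⌊c/2⌋}| where A_{⌊c/2⌋} = {u ∈ V(G)∖V(C) : d_C(u) = ⌊c/2⌋}. Then e(G) ≤ e(G[C]) + t·m + (t − 1/2)·(n − c − m). -/
open SimpleGraph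

namespace Stmt11
section
open scoped Classical
variable {V : Type*} {G : SimpleGraph V}

def IsP (G : SimpleGraph V) (L : List V) (a b : V) : Prop :=
  L.Nodup ∧ L.IsChain G.Adj ∧ L.head? = some a ∧ L.getLast? = some b

lemma IsP.single (a : V) : IsP G [a] a a := by simp [IsP]

lemma IsP.ne_nil {L : List V} {a b : V} (h : IsP G L a b) : L ≠ [] := by
  rintro rfl; simp [IsP] at h

lemma IsP.head_mem {L : List V} {a b : V} (h : IsP G L a b) : a ∈ L :=
  List.mem_of_head? h.2.2.1

lemma IsP.last_mem {L : List V} {a b : V} (h : IsP G L a b) : b ∈ L :=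
  List.mem_of_getLast? h.2.2.2

lemma IsP.reverse {L : List V} {a b : V} (h : IsP G L a b) : IsP G L.reverse b a := by
  obtain ⟨h1, h2, h3, h4⟩ := h
  refine ⟨List.nodup_reverse.2 h1, ?_, by simpa using h4, by simpa using h3⟩
  rw [List.isChain_reverse]
  exact h2.imp (fun _ _ h => h.symm)

lemma IsP.append {L M : List V} {a b c d : V} (h : IsP G L a b) (h' : IsP G M c d)
    (hbc : G.Adj b c) (hd : ∀ u ∈ L, u ∉ M) : IsP G (L ++ M) a d := by
  obtain ⟨h1, h2, h3, h4⟩ := h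
  obtain ⟨g1, g2, g3, g4⟩ := h'
  refine ⟨List.nodup_append'.2 ⟨h1, g1, fun u hu hv => hd u hu hv⟩, ?_, ?_, ?_⟩
  · rw [List.isChain_append]
    refine ⟨h2, g2, ?_⟩
    intro x hx y hy
    simp_all
  · simp [h3]
  · simp [g4]

lemma IsP.split {L M : List V} {u a b : V} (h : IsP G (L ++ u :: M) a b) :
    IsP G (L ++ [u]) a u ∧ IsP G (u :: M) u b := by
  obtain ⟨h1, h2, h3, h4⟩ := h
  refine ⟨⟨?_, ?_, ?_, ?_⟩, ⟨?_, ?_, ?_, ?_⟩⟩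
  · have : (L ++ [u]).Sublist (L ++ u :: M) := by simp
    exact h1.sublist this
  · have : (L ++ [u]) <+: (L ++ u :: M) := ⟨M, by simp⟩
    exact (List.isChain_append.1 (by simpa using h2 : ((L ++ [u]) ++ M).IsChain G.Adj)).1
  · cases L <;> simp_all
  · simp
  · exact h1.sublist (by simp)
  · exact (List.isChain_append.1 h2).2.1
  · simp
  · simpa using h4

lemma IsP.adj_mid {L M : List V} {u v a b : V} (h : IsP G (L ++ u :: v :: M) a b) :
    G.Adj u v := by
  have := h.2.1
  rw [List.isChain_append] at this
  exact (List.isChain_cons_cons.1 this.2.1).1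

lemma IsP.split2 {L M : List V} {u v a b : V} (h : IsP G (L ++ u :: v :: M) a b) :
    IsP G (L ++ [u]) a u ∧ IsP G (v :: M) v b := by
  refine ⟨h.split.1, ?_⟩
  have : IsP G ((L ++ [u]) ++ v :: M) a b := by simpa using h
  exact this.split.2

lemma IsP.join {L M : List V} {a b c : V} (h : IsP G L a b) (h' : IsP G M b c)
    (hd : ∀ u ∈ L, u ∈ M → u = b) :
    ∃ N, IsP G N a c ∧ N.length + 1 = L.length + M.length ∧ ∀ u, u ∈ N ↔ u ∈ L ∨ u ∈ M := by
  obtain ⟨M', rfl⟩ : ∃ M', M = b :: M' := by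
    cases M with
    | nil => exact absurd rfl h'.ne_nil
    | cons x M' => have := h'.2.2.1; simp at this; exact ⟨M', by rw [this]⟩
  have hb := h.last_mem
  cases M' with
  | nil =>
    have : b = c := by simpa using h'.2.2.2
    subst this
    refine ⟨L, h, by simp, ?_⟩
    intro u; simp; rintro rfl; exact hb
  | cons x M' =>
    have hx : IsP G ([] ++ b :: x :: M') b c := by simpa using h'
    refine ⟨L ++ x :: M', h.append hx.split2.2 hx.adj_mid ?_, ?_, ?_⟩
    · intro u hu hu'
      have := hd u hu (List.mem_cons_of_mem _ hu')
      subst this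
      exact (List.nodup_cons.1 h'.1).1 hu'
    · simp; omega
    · intro u; simp
      constructor
      · rintro (h | h | h) <;> simp [h]
      · rintro (h | h | h | h)
        · exact Or.inl h
        · subst h; exact Or.inl hb
        · simp [h]
        · simp [h]

def Lam (G : SimpleGraph V) (S : Finset V) (x y : V) (n : ℕ) : Prop :=
  ∃ L, IsP G L x y ∧ n + 2 ≤ L.length ∧ 3 ≤ L.length ∧ x ∉ S ∧ y ∉ S ∧
    ∀ u ∈ L, u ∈ S ∨ u = x ∨ u = y

def TC (G : SimpleGraph V) (S : Finset V) : Prop :=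
  ∀ D ⊆ S, D.Nonempty → ∀ z, ∃ u ∈ D, ∃ y, y ∉ D ∧ y ≠ z ∧ G.Adj u y

def MM (G : SimpleGraph V) (S : Finset V) (t : ℕ) : Prop :=
  ∀ (x0 : V) (Y : Finset V) (n : ℕ), Y.Nonempty → (∀ y ∈ Y, Lam G S x0 y n) →
    (∀ y ∈ Y, ∀ y' ∈ Y, y ≠ y' → Lam G S y y' 1) → Y.card + n ≤ t

lemma IsP.eq_of_len {L : List V} {a : V} (h : IsP G L a a) : L.length ≤ 1 := by
  obtain ⟨h1, h2, h3, h4⟩ := h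
  cases L with
  | nil => simp
  | cons x L =>
    simp at h3; subst h3
    rcases L.eq_nil_or_concat' with rfl | ⟨M, y, rfl⟩
    · simp
    · rw [← List.cons_append, List.getLast?_concat] at h4
      simp at h4; subst h4; simp at h1

lemma Lam.ne {S : Finset V} {x y : V} {n : ℕ} (h : Lam G S x y n) : x ≠ y := by
  obtain ⟨L, h1, h2, h3, _⟩ := h
  rintro rfl
  have := h1.eq_of_len
  omega

lemma Lam.symm {S : Finset V} {x y : V} {n : ℕ} (h : Lam G S x y n) : Lam G S y x n := by
  obtain ⟨L, h1, h2, h3, h4, h5, h6⟩ := h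
  refine ⟨L.reverse, h1.reverse, by simpa, by simpa, h5, h4, ?_⟩
  intro u hu
  have := h6 u (by simpa using hu)
  tauto

lemma MM.mono {G' : SimpleGraph V} {S S' : Finset V} {t : ℕ} (h : MM G S t)
    (hL : ∀ x y n, Lam G' S' x y n → Lam G S x y n) : MM G' S' t :=
  fun x0 Y n hY h1 h2 => h x0 Y n hY (fun y hy => hL _ _ _ (h1 y hy))
    (fun y hy y' hy' hne => hL _ _ _ (h2 y hy y' hy' hne))

lemma MM.one {S : Finset V} {t : ℕ} (h : MM G S t) {x y : V} {n : ℕ} (hL : Lam G S x y n) :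
    n + 1 ≤ t := by
  have := h x {y} n (by simp) (by simpa using hL) (by simp +contextual)
  simp at this; omega

/-- The linking lemma. -/
lemma link [Fintype V] {S : Finset V} (hTC : TC G S) (N : ℕ) (hN : 2 ≤ N) (x0 : V) (hx0 : x0 ∉ S) :
    ∀ (r : ℕ) (K : Finset V) (p : V) (A : List V), Kᶜ.card = r → IsP G A x0 p →
      (∀ u ∈ A, u ≠ x0 → u ∈ S) → (∀ u ∈ A, u ∈ K → u = p) → p ∈ K →
      (∃ q ∈ K, q ≠ p) → (∀ q ∈ K, q ≠ p → q ∈ S) →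
      (∀ q ∈ K, q ≠ p → (∃ z, z ∉ K ∧ G.Adj q z) →
        ∃ L, IsP G L p q ∧ N ≤ L.length ∧ ∀ u ∈ L, u ∈ K) →
      ∃ y, Lam G S x0 y (N - 1) := by
  intro r
  induction r using Nat.strong_induction_on with
  | _ r ih =>
  intro K p A hr hA hAS hAK hpK hne hKS hlink
  by_cases hc : ∃ q ∈ K, q ≠ p ∧ ∃ y, y ∉ K ∧ y ∉ A ∧ G.Adj q y
  · obtain ⟨q, hqK, hqp, y, hyK, hyA, hqy⟩ := hc
    obtain ⟨L, hL, hLN, hLK⟩ := hlink q hqK hqp ⟨y, hyK, hqy⟩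
    have hLy : IsP G (L ++ [y]) p y := hL.append (IsP.single y) hqy (by
      intro u hu; simp; rintro rfl; exact hyK (hLK _ hu))
    by_cases hyS : y ∈ S
    · refine ih (insert y K)ᶜ.card ?_ (insert y K) p A rfl hA hAS ?_ (by simp [hpK])
        ⟨q, by simp [hqK], hqp⟩ ?_ ?_
      · rw [← hr]
        apply Finset.card_lt_card
        rw [Finset.compl_ssubset_compl]
        exact Finset.ssubset_insert hyK
      · intro u hu huK
        rcases Finset.mem_insert.1 huK with rfl | h
        · exact absurd hu hyA
        · exact hAK u hu h
      · intro q' hq' hq'p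
        rcases Finset.mem_insert.1 hq' with rfl | h
        · exact hyS
        · exact hKS q' h hq'p
      · intro q' hq' hq'p ⟨z, hz, hz'⟩
        rcases Finset.mem_insert.1 hq' with rfl | h
        · refine ⟨_, hLy, by simp; omega, ?_⟩
          intro u hu
          simp at hu
          rcases hu with hu | rfl
          · simp [hLK u hu]
          · simp
        · obtain ⟨L', h1, h2, h3⟩ := hlink q' h hq'p ⟨z, fun hh => hz (by simp [hh]), hz'⟩
          exact ⟨L', h1, h2, fun u hu => by simp [h3 u hu]⟩
    · obtain ⟨M, hM, hMl, hMm⟩ := hA.join hLy (by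
        intro u hu hu'
        simp at hu'
        rcases hu' with hu' | rfl
        · exact hAK u hu (hLK u hu')
        · exact absurd hu hyA)
      have hAl : 1 ≤ A.length := List.length_pos_iff.2 hA.ne_nil
      simp at hMl
      refine ⟨y, M, hM, by omega, by omega, hx0, hyS, ?_⟩
      intro u hu
      rw [hMm] at hu
      simp at hu
      rcases hu with hu | hu | hu
      · by_cases h : u = x0
        · simp [h]
        · exact Or.inl (hAS u hu h)
      · by_cases h : u = p
        · subst h
          by_cases h : u = x0
          · simp [h]
          · exact Or.inl (hAS u hA.last_mem h)
        · exact Or.inl (hKS u (hLK u hu) h)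
      · simp [hu]
  · push Not at hc
    -- the exits lie on A
    let ex : V → Prop := fun y => y ∉ K ∧ ∃ q ∈ K, q ≠ p ∧ G.Adj q y
    have hex : ∀ y, ex y → y ∈ A := by
      rintro y ⟨hy, q, hq, hqp, hqy⟩
      by_contra h
      exact hc q hq hqp y hy h hqy
    have hexex : ∃ y, ex y := by
      obtain ⟨u, hu, y, hy, hyp, huy⟩ := hTC (K.erase p) (by
        intro u hu; exact hKS u (Finset.mem_of_mem_erase hu) (Finset.ne_of_mem_erase hu))
        (by obtain ⟨q, hq, hqp⟩ := hne; exact ⟨q, by simp [hq, hqp]⟩) p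
      refine ⟨y, ?_, u, Finset.mem_of_mem_erase hu, Finset.ne_of_mem_erase hu, huy⟩
      intro h; exact hy (by simp [h, hyp])
    have hdec : ∃ n, ∃ A1 y A2, A = A1 ++ y :: A2 ∧ ex y ∧ A1.length = n := by
      obtain ⟨y, hy⟩ := hexex
      obtain ⟨A1, A2, h⟩ := List.append_of_mem (hex y hy)
      exact ⟨_, A1, y, A2, h, hy, rfl⟩
    obtain ⟨A1, y, A2, hAeq, hy, hAn⟩ := Nat.find_spec hdec
    have hmin : ∀ z ∈ A1, ¬ ex z := by
      intro z hz hzex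
      obtain ⟨B1, B2, hB⟩ := List.append_of_mem hz
      refine Nat.find_min hdec (m := B1.length) ?_ ⟨B1, z, B2 ++ y :: A2, ?_, hzex, rfl⟩
      · rw [← hAn, hB]; simp
      · rw [hAeq, hB]; simp
    clear hdec hAn
    obtain ⟨hyK, q, hqK, hqp, hqy⟩ := hy
    obtain ⟨L, hL, hLN, hLK⟩ := hlink q hqK hqp ⟨y, hyK, hqy⟩
    have hyp : y ≠ p := fun h => hyK (h ▸ hpK)
    have hA' := hA
    rw [hAeq] at hA'
    obtain ⟨hA1, hA2⟩ := hA'.split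
    have hnd := hA'.1
    have hpA2 : p ∈ A2 := by
      have := hA2.last_mem
      simp at this
      rcases this with h | h
      · exact absurd h.symm hyp
      · exact h
    have hx0A2 : x0 ∉ A2 := by
      have := hA1.head_mem
      rw [List.nodup_append'] at hnd
      simp at this
      rcases this with h | rfl
      · intro h'; exact hnd.2.2 h (by simp [h'])
      · exact (List.nodup_cons.1 hnd.2.1).1
    have hK' : ∀ u, u ∈ K ∪ (y :: A2).toFinset ↔ u ∈ K ∨ u = y ∨ u ∈ A2 := by
      intro u; simp only [Finset.mem_union, List.mem_toFinset, List.mem_cons]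
    refine ih (K ∪ (y :: A2).toFinset)ᶜ.card ?_ (K ∪ (y :: A2).toFinset) y (A1 ++ [y]) rfl hA1
      ?_ ?_ (by simp) ⟨p, by simp [hpK], hyp.symm⟩ ?_ ?_
    · rw [← hr]
      apply Finset.card_lt_card
      rw [Finset.compl_ssubset_compl]
      refine Finset.ssubset_iff_subset_ne.2 ⟨Finset.subset_union_left, ?_⟩
      intro h; apply hyK; rw [h]; simp
    · intro u hu; apply hAS; rw [hAeq]; simp at hu ⊢; tauto
    · intro u hu huK
      rw [hK'] at huK
      simp at hu
      rcases hu with hu | hu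
      swap; exact hu
      exfalso
      rw [List.nodup_append'] at hnd
      rcases huK with h | h
      · have := hAK u (by rw [hAeq]; simp [hu]) h
        subst this
        exact hnd.2.2 hu (by simp [hpA2])
      · exact hnd.2.2 hu (by simpa using h)
    · intro q' hq' hq'y
      rw [hK'] at hq'
      have : ∀ u ∈ A2, u ∈ S := by
        intro u hu
        apply hAS u (by rw [hAeq]; simp [hu])
        rintro rfl; exact hx0A2 hu
      rcases hq' with h | h | h
      · by_cases h' : q' = p
        · subst h'; exact this _ hpA2
        · exact hKS q' h h'
      · exact absurd h hq'y
      · exact this _ h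
    · intro q' hq' hq'y ⟨z, hz, hq'z⟩
      by_cases h : q' ∈ K ∧ q' ≠ p
      · exfalso
        have hzex : ex z := ⟨fun h => hz (by simp [h]), q', h.1, h.2, hq'z⟩
        have h2 := hex z hzex
        rw [hAeq] at h2
        rw [hK'] at hz
        have h3 := hmin z
        simp at h2
        clear_value ex
        clear hlink hex hmin hc
        tauto
      · have hq'A2 : q' ∈ A2 := by
          rw [hK'] at hq'
          by_cases h' : q' = p
          · subst h'; exact hpA2
          · rcases hq' with h1 | h1 | h1
            · exact absurd ⟨h1, h'⟩ h
            · exact absurd h1 hq'y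
            · exact h1
        obtain ⟨B1, B2, rfl⟩ := List.append_of_mem hq'A2
        have hB : IsP G ((y :: B1) ++ q' :: B2) y p := by simpa using hA2
        have hB2 := hB.split.2.reverse
        have hyL : IsP G ([y] ++ L.reverse) y p := (IsP.single y).append hL.reverse hqy.symm (by
          intro u hu hu'
          simp at hu hu'
          subst hu
          exact hyK (hLK _ hu'))
        have hyB := (List.nodup_append'.1 hB.1).2.2
        obtain ⟨M, hM, hMl, hMm⟩ := hyL.join hB2 (by
          intro u hu hu'
          simp only [List.mem_append, List.mem_singleton, List.mem_reverse] at hu hu'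
          rcases hu with rfl | hu
          · exact absurd hu' (fun h => hyB (a := u) (by simp) h)
          · exact hAK u (by rw [hAeq]; simp only [List.mem_append, List.mem_cons] at hu' ⊢; exact Or.inr (Or.inr (Or.inr hu'))) (hLK u hu))
        refine ⟨M, hM, ?_, ?_⟩
        · simp at hMl; omega
        · intro u hu
          rw [hMm] at hu
          simp only [List.mem_append, List.mem_reverse, List.mem_cons] at hu
          rw [hK']
          simp only [List.mem_append, List.mem_cons]
          rcases hu with (hu | hu) | hu
          · exact Or.inr (Or.inl (by simpa using hu))
          · exact Or.inl (hLK u hu)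
          · exact Or.inr (Or.inr (Or.inr hu))
end
end Stmt11

namespace Stmt11
section
open scoped Classical
variable {V : Type*} {G : SimpleGraph V}

noncomputable def FF [Fintype V] (G : SimpleGraph V) (S : Finset V) : ℕ :=
  (Finset.univ.filter fun p : V × V => G.Adj p.1 p.2 ∧ (p.1 ∈ S ∨ p.2 ∈ S)).card

noncomputable def dT [Fintype V] (G : SimpleGraph V) (S : Finset V) (u : V) : ℕ :=
  (Finset.univ.filter fun y : V => G.Adj u y ∧ y ∉ S).card

noncomputable def mm [Fintype V] (G : SimpleGraph V) (S : Finset V) (t : ℕ) : ℕ :=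
  (S.filter fun u => t ≤ dT G S u).card

def Good [Fintype V] (G : SimpleGraph V) (S : Finset V) (t : ℕ) : Prop :=
  FF G S + S.card ≤ 2 * t * S.card + mm G S t

lemma FF_le [Fintype V] {G' : SimpleGraph V} {S D S' : Finset V}
    (h : ∀ a b, G.Adj a b → (a ∈ S ∨ b ∈ S) →
      (a ∈ D ∨ b ∈ D) ∨ (G'.Adj a b ∧ (a ∈ S' ∨ b ∈ S'))) :
    FF G S ≤ FF G D + FF G' S' := by
  unfold FF
  refine le_trans (Finset.card_le_card ?_) (Finset.card_union_le _ _)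
  intro p hp
  simp only [Finset.mem_filter, Finset.mem_univ, true_and, Finset.mem_union] at hp ⊢
  have := h _ _ hp.1 hp.2
  tauto

lemma FF_single [Fintype V] (v : V) :
    FF G {v} ≤ 2 * (Finset.univ.filter fun y => G.Adj v y).card := by
  unfold FF
  have : (Finset.univ.filter fun p : V × V => G.Adj p.1 p.2 ∧ (p.1 ∈ ({v} : Finset V) ∨ p.2 ∈ ({v} : Finset V)))
    ⊆ ((Finset.univ.filter fun y => G.Adj v y).image fun y => (v, y)) ∪
      ((Finset.univ.filter fun y => G.Adj v y).image fun y => (y, v)) := by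
    rintro ⟨a, b⟩ hp
    simp at hp ⊢
    rcases hp with ⟨h, rfl | rfl⟩
    · simp [h]
    · simp [h.symm]
  refine le_trans (Finset.card_le_card this) (le_trans (Finset.card_union_le _ _) ?_)
  have h1 := Finset.card_image_le (s := Finset.univ.filter fun y => G.Adj v y) (f := fun y => (v, y))
  have h2 := Finset.card_image_le (s := Finset.univ.filter fun y => G.Adj v y) (f := fun y => (y, v))
  omega

lemma TC.subset {S D : Finset V} (h : TC G S) (hD : D ⊆ S) : TC G D :=
  fun D' hD' hne z => h D' (hD'.trans hD) hne z

lemma Lam.adj {S : Finset V} {x y : V} {n : ℕ} (h : Lam G S x y n) : ∃ u ∈ S, G.Adj x u := by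
  obtain ⟨L, h1, h2, h3, h4, h5, h6⟩ := h
  match L, h1, h3, h6 with
  | a :: b :: c :: L, h1, h3, h6 =>
    have ha : a = x := by simpa using h1.2.2.1
    subst ha
    have hb : b ≠ y := by
      rintro rfl
      have := h1.split (L := [a]) (u := b) |>.2.eq_of_len
      simp at this
    have hab := h1.adj_mid (L := [])
    refine ⟨b, ?_, hab⟩
    have := h6 b (by simp)
    rcases this with h | h | h
    · exact h
    · exact absurd h hab.ne'
    · exact absurd h hb

/-! Disconnected case. -/
lemma case0 [Fintype V] {S D : Finset V} {t : ℕ} (hDS : D ⊆ S)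
    (hno : ∀ u ∈ D, ∀ y ∈ S, y ∉ D → ¬ G.Adj u y) (h1 : Good G D t) (h2 : Good G (S \ D) t) :
    Good G S t := by
  unfold Good at *
  have hF : FF G S ≤ FF G D + FF G (S \ D) := by
    apply FF_le
    intro a b hab h
    simp only [Finset.mem_sdiff]
    tauto
  have hc := Finset.card_sdiff_add_card_eq_card hDS
  have hm : mm G D t + mm G (S \ D) t ≤ mm G S t := by
    unfold mm
    rw [← Finset.card_union_of_disjoint]
    · apply Finset.card_le_card
      intro u hu
      simp only [Finset.mem_filter, Finset.mem_union, Finset.mem_sdiff] at hu ⊢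
      rcases hu with ⟨hu, hd⟩ | ⟨hu, hd⟩
      · refine ⟨hDS hu, hd.trans (Finset.card_le_card ?_)⟩
        intro y hy
        simp only [Finset.mem_filter, Finset.mem_univ, true_and] at hy ⊢
        exact ⟨hy.1, fun h => hno u hu y h hy.2 hy.1⟩
      · refine ⟨hu.1, hd.trans (Finset.card_le_card ?_)⟩
        intro y hy
        simp only [Finset.mem_filter, Finset.mem_univ, true_and, Finset.mem_sdiff] at hy ⊢
        refine ⟨hy.1, fun h => ?_⟩
        by_cases hyD : y ∈ D
        · exact hno y hyD u hu.1 hu.2 hy.1.symm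
        · exact hy.2 ⟨h, hyD⟩
    · rw [Finset.disjoint_left]
      intro u hu hu'
      simp only [Finset.mem_filter, Finset.mem_sdiff] at hu hu'
      exact hu'.1.2 hu.1
  rw [← hc, Nat.mul_add]
  omega

lemma MM.comp {S D : Finset V} {t : ℕ} (h : MM G S t) (hDS : D ⊆ S)
    (hno : ∀ u ∈ D, ∀ y ∈ S, y ∉ D → ¬ G.Adj u y) : MM G D t := by
  apply h.mono
  intro x y n hL
  have hx : ∀ {x y}, Lam G D x y n → x ∉ S := by
    intro x y hL hxS
    obtain ⟨u, hu, hxu⟩ := hL.adj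
    obtain ⟨L, h1, h2, h3, h4, h5, h6⟩ := hL
    exact hno u hu x hxS h4 hxu.symm
  have hxS := hx hL
  have hyS := hx hL.symm
  obtain ⟨L, h1, h2, h3, h4, h5, h6⟩ := hL
  refine ⟨L, h1, h2, h3, hxS, hyS, ?_⟩
  intro u hu
  have := h6 u hu
  have := @hDS u
  tauto

lemma reach [Fintype V] {S : Finset V} (hTC : TC G S) : ∀ (r : ℕ) (K : Finset V), Kᶜ.card = r →
    K ⊆ S → K.Nonempty → ∃ A x0 p, IsP G A x0 p ∧ x0 ∉ S ∧ p ∈ K ∧ (∀ u ∈ A, u ≠ x0 → u ∈ S) ∧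
      (∀ u ∈ A, u ∈ K → u = p) := by
  intro r
  induction r using Nat.strong_induction_on with
  | _ r ih =>
  intro K hr hKS hK
  obtain ⟨u, hu, y, hy, -, huy⟩ := hTC K hKS hK hK.choose
  by_cases hyS : y ∈ S
  · obtain ⟨A, x0, p, h1, h2, h3, h4, h5⟩ := ih (insert y K)ᶜ.card (by
      rw [← hr]
      apply Finset.card_lt_card
      rw [Finset.compl_ssubset_compl]
      exact Finset.ssubset_insert hy) _ rfl (by
        intro v hv
        rcases Finset.mem_insert.1 hv with rfl | h
        · exact hyS
        · exact hKS h) (by simp)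
    rcases Finset.mem_insert.1 h3 with rfl | h
    · have huA : u ∉ A := by
        intro h
        have := h5 u h (by simp [hu])
        subst this; exact hy hu
      refine ⟨A ++ [u], x0, u, h1.append (IsP.single u) huy.symm ?_, h2, hu, ?_, ?_⟩
      · intro v hv; simp; rintro rfl; exact huA hv
      · intro v hv hv'
        simp at hv
        rcases hv with hv | rfl
        · exact h4 v hv hv'
        · exact hKS hu
      · intro v hv hvK
        simp at hv
        rcases hv with hv | rfl
        · have := h5 v hv (by simp [hvK])
          subst this; exact absurd hvK hy
        · rfl
    · exact ⟨A, x0, p, h1, h2, h, h4, fun u hu hK => h5 u hu (by simp [hK])⟩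
  · refine ⟨[y] ++ [u], y, u, (IsP.single y).append (IsP.single u) huy.symm ?_, hyS, hu, ?_, ?_⟩
    · intro v hv; simp at hv ⊢; subst hv; exact huy.ne'
    · intro v hv hv'
      simp at hv
      rcases hv with rfl | rfl
      · exact absurd rfl hv'
      · exact hKS hu
    · intro v hv hvK
      simp at hv
      rcases hv with rfl | rfl
      · exact absurd hvK hy
      · rfl

lemma lift0 [Fintype V] {S D : Finset V} (hTC : TC G S) (hDS : D ⊆ S) {p q : V} (hqD : q ∉ D)
    (hpq : p ≠ q)
    (hqS : q ∈ S) (hN : ∀ u ∈ D, ∀ y, G.Adj u y → y ∈ D ∨ y = p ∨ y = q)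
    {L : List V} {n : ℕ} (hL : IsP G L p q) (hLn : n + 2 ≤ L.length)
    (hLD : ∀ u ∈ L, u ∈ D ∨ u = p ∨ u = q)
    {A : List V} {x0 : V} (hA : IsP G A x0 p) (hx0 : x0 ∉ S) (hAS : ∀ u ∈ A, u ≠ x0 → u ∈ S)
    (hAK : ∀ u ∈ A, (u ∈ D ∨ u = p ∨ u = q) → u = p) : ∃ y, Lam G S x0 y (n + 1) := by
  have hK : ∀ u, u ∈ D ∪ {p, q} ↔ u ∈ D ∨ u = p ∨ u = q := by intro u; simp; tauto
  refine link hTC (n + 2) (by omega) x0 hx0 _ (D ∪ {p, q}) p A rfl hA hAS ?_ ?_ ⟨q, ?_, hpq.symm⟩ ?_ ?_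
  · intro u hu huK; rw [hK] at huK; exact hAK u hu huK
  · simp [hK]
  · simp [hK]
  · intro u hu hup
    rw [hK] at hu
    rcases hu with h | h | h
    · exact hDS h
    · exact absurd h hup
    · rw [h]; exact hqS
  · intro u hu hup ⟨z, hz, huz⟩
    rw [hK] at hu hz
    rcases hu with h | h | h
    · exact absurd (hN u h z huz) hz
    · exact absurd h hup
    · subst h
      exact ⟨L, hL, hLn, fun v hv => by rw [hK]; exact hLD v hv⟩

lemma lift1 [Fintype V] {S D : Finset V} (hTC : TC G S) (hDS : D ⊆ S) {z w : V}
    (hN : ∀ u ∈ D, ∀ y, G.Adj u y → y ∈ D ∨ y = z ∨ y = w)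
    {n : ℕ} (hL : Lam G D z w n) (hzw : z ∈ S ∨ w ∈ S) : ∃ x y, Lam G S x y (n + 1) := by
  have hne := hL.ne
  have hL' := hL.symm
  obtain ⟨L, h1, h2, h3, h4, h5, h6⟩ := hL
  obtain ⟨L', h1', h2', h3', h4', h5', h6'⟩ := hL'
  have hN' : ∀ u ∈ D, ∀ y, G.Adj u y → y ∈ D ∨ y = w ∨ y = z := by
    intro u hu y hy; have := hN u hu y hy; tauto
  by_cases hzS : z ∈ S
  · by_cases hwS : w ∈ S
    · have hK : ∀ u, u ∈ D ∪ {z, w} ↔ u ∈ D ∨ u = z ∨ u = w := by intro u; simp; tauto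
      obtain ⟨A, x0, p, g1, g2, g3, g4, g5⟩ := reach hTC _ (D ∪ {z, w}) rfl (by
        intro u hu
        rw [hK] at hu
        rcases hu with h | rfl | rfl
        · exact hDS h
        · exact hzS
        · exact hwS) ⟨z, by simp [hK]⟩
      simp only [hK] at g3 g5
      rcases g3 with h | rfl | rfl
      · exfalso
        rcases A.eq_nil_or_concat' with rfl | ⟨B, c, rfl⟩
        · exact g1.ne_nil rfl
        have hc : c = p := by have := g1.2.2.2; simpa using this
        subst hc
        rcases B.eq_nil_or_concat' with rfl | ⟨B, d, rfl⟩
        · have := g1.head_mem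
          simp at this; subst this; exact g2 (hDS h)
        have g1' : IsP G (B ++ d :: c :: []) x0 c := by simpa using g1
        have hdc := g1'.adj_mid
        have := g5 d (by simp) (hN c h d hdc.symm)
        exact hdc.ne this
      · exact ⟨x0, lift0 hTC hDS h5 hne hwS hN h1 h2 h6 g1 g2 g4 g5⟩
      · refine ⟨x0, lift0 hTC hDS h4 hne.symm hzS hN' h1' h2' h6' g1 g2 g4 ?_⟩
        intro u hu h; exact g5 u hu (by tauto)
    · refine ⟨w, lift0 hTC hDS h4 hne.symm hzS hN' h1' h2' h6' (IsP.single w) hwS ?_ ?_⟩ <;> simp +contextual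
  · refine ⟨z, lift0 hTC hDS h5 hne (by tauto) hN h1 h2 h6 (IsP.single z) hzS ?_ ?_⟩ <;> simp +contextual

lemma MM.cut [Fintype V] {S D : Finset V} {t : ℕ} (hM : MM G S t) (hTC : TC G S) (hDS : D ⊆ S) {z w : V}
    (hN : ∀ u ∈ D, ∀ y, G.Adj u y → y ∈ D ∨ y = z ∨ y = w)
    (hzw : z ∈ S ∨ w ∈ S) : MM G D (t - 1) := by
  have key : ∀ {x y n}, Lam G D x y n → x = z ∨ x = w := by
    intro x y n hL
    obtain ⟨u, hu, hxu⟩ := hL.adj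
    obtain ⟨L, h1, h2, h3, h4, h5, h6⟩ := hL
    have := hN u hu x hxu.symm
    tauto
  intro x0 Y n hY h1 h2
  obtain ⟨y, hy⟩ := hY
  have hYy : Y = {y} := by
    rw [Finset.eq_singleton_iff_unique_mem]
    refine ⟨hy, ?_⟩
    intro y' hy'
    have a1 := key (h1 y hy)
    have a2 := key (h1 y hy).symm
    have a3 := key (h1 y' hy').symm
    have a4 := (h1 y hy).ne
    have a5 := (h1 y' hy').ne
    grind
  have : ∃ x y, Lam G S x y (n + 1) := by
    have a1 := key (h1 y hy)
    have a2 := key (h1 y hy).symm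
    have a4 := (h1 y hy).ne
    have hL := h1 y hy
    have : (x0 = z ∧ y = w) ∨ (x0 = w ∧ y = z) := by grind
    rcases this with ⟨rfl, rfl⟩ | ⟨rfl, rfl⟩
    · exact lift1 hTC hDS hN hL hzw
    · exact lift1 hTC hDS hN hL.symm hzw
  obtain ⟨a, b, hab⟩ := this
  have := hM.one hab
  subst hYy
  simp
  omega

lemma dpath [Fintype V] {D : Finset V} (hTC : TC G D) {z w : V} (hD : D.Nonempty) (hz : z ∉ D)
    (hN : ∀ u ∈ D, ∀ y, G.Adj u y → y ∈ D ∨ y = z ∨ y = w) : Lam G D z w 1 := by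
  obtain ⟨u, hu, y, hy, hyw, huy⟩ := hTC D subset_rfl hD w
  have : y = z := by have := hN u hu y huy; tauto
  subst this
  have hP : IsP G ([y] ++ [u]) y u := (IsP.single y).append (IsP.single u) huy.symm (by
    intro v hv; simp at hv ⊢; subst hv; exact huy.ne')
  obtain ⟨x, hx⟩ := link hTC 2 le_rfl y hz _ {y, u} y [y] rfl (IsP.single y) (by simp +contextual)
    (by simp +contextual) (by simp) ⟨u, by simp, huy.ne⟩ (by
      intro q hq hqy; simp at hq; rcases hq with rfl | rfl
      · exact absurd rfl hqy
      · exact hu) (by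
      intro q hq hqy _
      simp at hq; rcases hq with rfl | rfl
      · exact absurd rfl hqy
      · exact ⟨_, hP, by simp, by simp⟩)
  have hne := hx.ne
  obtain ⟨v, hv, hxv⟩ := hx.symm.adj
  have hx' := hN v hv x hxv.symm
  have hxD : x ∉ D := by obtain ⟨L, h1, h2, h3, h4, h5, h6⟩ := hx; exact h5
  have : x = w := by
    rcases hx' with h | h | h
    · exact absurd h hxD
    · exact absurd h.symm hne
    · exact h
  subst this
  exact hx

def gc (G : SimpleGraph V) (D : Finset V) (z w : V) : SimpleGraph V where
  Adj a b := (G.Adj a b ∧ a ∉ D ∧ b ∉ D) ∨ (a ≠ b ∧ ((a = z ∧ b = w) ∨ (a = w ∧ b = z)))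
  symm := ⟨by
    rintro a b (h | h)
    · exact Or.inl ⟨h.1.symm, h.2.2, h.2.1⟩
    · exact Or.inr ⟨h.1.symm, by tauto⟩⟩
  loopless := ⟨by
    rintro a (h | h)
    · exact G.loopless.1 a h.1
    · exact h.1 rfl⟩

lemma gc_adj {D : Finset V} {z w a b : V} : (gc G D z w).Adj a b ↔
    (G.Adj a b ∧ a ∉ D ∧ b ∉ D) ∨ (a ≠ b ∧ ((a = z ∧ b = w) ∨ (a = w ∧ b = z))) := Iff.rfl

lemma gc_chain {D : Finset V} {z w : V} (L : List V) (h : L.IsChain (gc G D z w).Adj) :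
    L.IsChain G.Adj ∨ ∃ A B a b, L = A ++ a :: b :: B ∧ ((a = z ∧ b = w) ∨ (a = w ∧ b = z)) := by
  induction L with
  | nil => simp
  | cons x L ih =>
    cases L with
    | nil => simp
    | cons y L =>
      rw [List.isChain_cons_cons] at h
      by_cases hxy : (x = z ∧ y = w) ∨ (x = w ∧ y = z)
      · exact Or.inr ⟨[], L, x, y, rfl, hxy⟩
      · rcases ih h.2 with h' | ⟨A, B, a, b, h1, h2⟩
        · left
          rw [List.isChain_cons_cons]
          refine ⟨?_, h'⟩
          have := gc_adj.1 h.1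
          tauto
        · exact Or.inr ⟨x :: A, B, a, b, by rw [h1]; rfl, h2⟩

lemma gc_lam {S D : Finset V} {z w : V} (hDS : D ⊆ S) (hd : Lam G D z w 1) {x y : V} {n : ℕ}
    (hL : Lam (gc G D z w) (S \ D) x y n) : Lam G S x y n := by
  have hzwD : z ∉ D ∧ w ∉ D := by
    obtain ⟨L, h1, h2, h3, h4, h5, h6⟩ := hd; exact ⟨h4, h5⟩
  have key : ∀ {x y}, Lam (gc G D z w) (S \ D) x y n → x ∉ D := by
    intro x y hL
    obtain ⟨u, hu, hxu⟩ := hL.adj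
    rcases gc_adj.1 hxu with h | h
    · exact h.2.1
    · rcases h.2 with h | h
      · rw [h.1]; exact hzwD.1
      · rw [h.1]; exact hzwD.2
  have hxD := key hL
  have hyD := key hL.symm
  obtain ⟨L, h1, h2, h3, h4, h5, h6⟩ := hL
  simp only [Finset.mem_sdiff, not_and, not_not] at h4 h5 h6
  have hxS : x ∉ S := fun h => hxD (h4 h)
  have hyS : y ∉ S := fun h => hyD (h5 h)
  have hLD : ∀ u ∈ L, u ∉ D := by
    intro u hu
    rcases h6 u hu with h | h | h
    · exact h.2
    · rw [h]; exact hxD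
    · rw [h]; exact hyD
  rcases gc_chain L h1.2.1 with hc | ⟨A, B, a, b, rfl, hab⟩
  · refine ⟨L, ⟨h1.1, hc, h1.2.2⟩, h2, h3, hxS, hyS, ?_⟩
    intro u hu; have := h6 u hu; tauto
  · have hd' : Lam G D a b 1 := by
      rcases hab with ⟨rfl, rfl⟩ | ⟨rfl, rfl⟩
      · exact hd
      · exact hd.symm
    obtain ⟨M, m1, m2, m3, m4, m5, m6⟩ := hd'
    obtain ⟨M', rfl⟩ : ∃ M', M = a :: M' := by
      cases M with
      | nil => exact absurd rfl m1.ne_nil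
      | cons c M' => have := m1.2.2.1; simp at this; exact ⟨M', by rw [this]⟩
    have hsp := h1.split2
    have hnd := List.nodup_append'.1 (show ((A ++ [a]) ++ b :: B).Nodup by simpa using h1.1)
    have hbA : b ∉ A ++ [a] := fun h => hnd.2.2 h (by simp)
    have haB : a ∉ b :: B := fun h => hnd.2.2 (show a ∈ A ++ [a] by simp) h
    have c1 : (A ++ [a]).IsChain G.Adj := by
      rcases gc_chain _ hsp.1.2.1 with h | ⟨A', B', a', b', h, h'⟩
      · exact h
      · exfalso; apply hbA; rw [h]
        grind
    have c2 : (b :: B).IsChain G.Adj := by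
      rcases gc_chain _ hsp.2.2.1 with h | ⟨A', B', a', b', h, h'⟩
      · exact h
      · exfalso; apply haB; rw [h]
        grind
    have p1 : IsP G (A ++ [a]) x a := ⟨hsp.1.1, c1, hsp.1.2.2⟩
    have p2 : IsP G (b :: B) b y := ⟨hsp.2.1, c2, hsp.2.2.2⟩
    obtain ⟨Q, q1, q2, q3⟩ := p1.join m1 (by
      intro u hu hu'
      rcases m6 u hu' with h | h | h
      · exact absurd h (hLD u (by simp at hu ⊢; tauto))
      · exact h
      · subst h; exact absurd hu hbA)
    obtain ⟨R, r1, r2, r3⟩ := q1.join p2 (by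
      intro u hu hu'
      rw [q3] at hu
      rcases hu with hu | hu
      · exact absurd hu' (fun h => hnd.2.2 hu h)
      · rcases m6 u hu with h | h | h
        · exact absurd h (hLD u (by simp at hu' ⊢; tauto))
        · subst h; exact absurd hu' haB
        · exact h)
    simp at q2 r2 h2 h3 m3
    refine ⟨R, r1, by omega, by omega, hxS, hyS, ?_⟩
    intro u hu
    rw [r3, q3] at hu
    have hh : u ∈ A ++ a :: b :: B → u ∈ S ∨ u = x ∨ u = y := by
      intro hu
      rcases h6 u hu with h | h | h
      · exact Or.inl h.1
      · exact Or.inr (Or.inl h)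
      · exact Or.inr (Or.inr h)
    rcases hu with (hu | hu) | hu
    · apply hh
      simp only [List.mem_append, List.mem_singleton] at hu
      rcases hu with h | h <;> simp [h]
    · rcases m6 u hu with h | h | h
      · exact Or.inl (hDS h)
      · apply hh; simp [h]
      · apply hh; simp [h]
    · apply hh
      simp only [List.mem_cons] at hu
      rcases hu with h | h <;> simp [h]

lemma gc_TC {S D : Finset V} {z w : V} (hTC : TC G S) (hDS : D ⊆ S) 
    (hN : ∀ u ∈ D, ∀ y, G.Adj u y → y ∈ D ∨ y = z ∨ y = w) :
    TC (gc G D z w) (S \ D) := by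
  intro E hE hEne r
  have hED : ∀ u ∈ E, u ∉ D := fun u hu => (Finset.mem_sdiff.1 (hE hu)).2
  have hES : E ⊆ S := fun u hu => (Finset.mem_sdiff.1 (hE hu)).1
  obtain ⟨u1, hu1, y1, hy1, hyr1, huy1⟩ := hTC E hES hEne r
  obtain ⟨u2, hu2, y2, hy2, hyr2, huy2⟩ := hTC (E ∪ D) (Finset.union_subset hES hDS)
    (hEne.mono Finset.subset_union_left) r
  simp only [Finset.mem_union, not_or] at hu2 hy2
  by_cases h2 : u2 ∈ E
  · exact ⟨u2, h2, y2, hy2.1, hyr2, gc_adj.2 (Or.inl ⟨huy2, hED _ h2, hy2.2⟩)⟩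
  have hu2D : u2 ∈ D := by tauto
  have hy2' : y2 = z ∨ y2 = w := by have := hN u2 hu2D y2 huy2; tauto
  by_cases hyD : y1 ∈ D
  · -- then u1 is z or w
    have hu1' := hN y1 hyD u1 huy1.symm
    have : u1 = z ∨ u1 = w := by have := hED u1 hu1; tauto
    have hny : u1 ≠ y2 := by rintro rfl; exact hy2.1 hu1
    refine ⟨u1, hu1, y2, hy2.1, hyr2, gc_adj.2 (Or.inr ⟨hny, ?_⟩)⟩
    grind
  · exact ⟨u1, hu1, y1, hy1, hyr1, gc_adj.2 (Or.inl ⟨huy1, hED _ hu1, hyD⟩)⟩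

lemma mm_le_card [Fintype V] (S : Finset V) (t : ℕ) : mm G S t ≤ S.card := Finset.card_filter_le _ _

lemma case1 [Fintype V] {S D : Finset V} {t : ℕ} {z w : V} (hDS : D ⊆ S) (hDne : D.Nonempty)
    (hTC : TC G S) (hwS : w ∈ S) (hwD : w ∉ D)
    (h1 : Good G D (t - 1)) (h2 : Good (gc G D z w) (S \ D) t) : Good G S t := by
  unfold Good at *
  have hF : FF G S ≤ FF G D + FF (gc G D z w) (S \ D) := by
    apply FF_le
    intro a b hab h
    rw [gc_adj]
    simp only [Finset.mem_sdiff]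
    tauto
  have hc := Finset.card_sdiff_add_card_eq_card hDS
  have hm1 := mm_le_card (G := G) D (t - 1)
  have hm : mm (gc G D z w) (S \ D) t ≤ mm G S t + 1 := by
    unfold mm
    rw [← Finset.card_singleton w]
    refine le_trans (Finset.card_le_card ?_) (Finset.card_union_le _ _)
    intro u hu
    simp only [Finset.mem_filter, Finset.mem_union, Finset.mem_sdiff, Finset.mem_singleton] at hu ⊢
    by_cases huw : u = w
    · exact Or.inr huw
    left
    refine ⟨hu.1.1, hu.2.trans (Finset.card_le_card ?_)⟩
    intro y hy
    simp only [Finset.mem_filter, Finset.mem_univ, true_and, Finset.mem_sdiff, gc_adj] at hy ⊢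
    obtain ⟨hy1, hy2⟩ := hy
    grind
  have hFD : 1 ≤ FF G D := by
    obtain ⟨u, hu, y, hy, -, huy⟩ := hTC D hDS hDne z
    unfold FF
    apply Finset.card_pos.2
    exact ⟨(u, y), by simp [huy, hu]⟩
  have hD1 : 1 ≤ D.card := Finset.card_pos.2 hDne
  have hFD' : FF G D ≤ 2 * (t - 1) * D.card := by omega
  have ht : 1 ≤ t := by
    by_contra h
    have : t = 0 := by omega
    subst this
    simp at hFD'
    omega
  obtain ⟨s, rfl⟩ : ∃ s, t = s + 1 := ⟨t - 1, by omega⟩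
  simp at hFD'
  rw [← hc]
  have e1 : 2 * (s + 1) * ((S \ D).card + D.card) = 2 * (s + 1) * (S \ D).card + 2 * s * D.card + 2 * D.card := by ring
  omega

end
end Stmt11

namespace Stmt11
section
open scoped Classical
variable {V : Type*} {G : SimpleGraph V}

lemma first_split (P : V → Prop) (l : List V) (h : ∃ x ∈ l, P x) :
    ∃ B p C, l = B ++ p :: C ∧ P p ∧ ∀ b ∈ B, ¬ P b := by
  induction l with
  | nil => simp at h
  | cons x l ih =>
    by_cases hx : P x
    · exact ⟨[], x, l, rfl, hx, by simp⟩
    · obtain ⟨B, p, C, h1, h2, h3⟩ := ih (by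
        obtain ⟨y, hy, hPy⟩ := h
        rcases List.mem_cons.1 hy with rfl | hy
        · exact absurd hPy hx
        · exact ⟨y, hy, hPy⟩)
      refine ⟨x :: B, p, C, by rw [h1]; rfl, h2, ?_⟩
      intro b hb
      rcases List.mem_cons.1 hb with rfl | hb
      · exact hx
      · exact h3 b hb

lemma last_split (P : V → Prop) (l : List V) (h : ∃ x ∈ l, P x) :
    ∃ B p C, l = B ++ p :: C ∧ P p ∧ ∀ b ∈ C, ¬ P b := by
  obtain ⟨B, p, C, h1, h2, h3⟩ := first_split P l.reverse (by simpa using h)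
  refine ⟨C.reverse, p, B.reverse, ?_, h2, by simpa using h3⟩
  have := congrArg List.reverse h1
  simpa using this

noncomputable def dg [Fintype V] (G : SimpleGraph V) (v : V) : ℕ :=
  (Finset.univ.filter fun y => G.Adj v y).card

lemma FF_bound [Fintype V] {S : Finset V} {d : ℕ} (h : ∀ u ∈ S, dT G S u ≤ d) :
    FF G S ≤ S.card * (2 * d) + (S.card * S.card - S.card) := by
  have hsub : (Finset.univ.filter fun p : V × V => G.Adj p.1 p.2 ∧ (p.1 ∈ S ∨ p.2 ∈ S)) ⊆
      (S.biUnion fun u => (Finset.univ.filter fun y => G.Adj u y ∧ y ∉ S).image fun y => (u, y)) ∪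
      (S.biUnion fun u => (Finset.univ.filter fun y => G.Adj u y ∧ y ∉ S).image fun y => (y, u)) ∪
      S.offDiag := by
    rintro ⟨a, b⟩ hp
    simp only [Finset.mem_filter, Finset.mem_univ, true_and] at hp
    simp only [Finset.mem_union, Finset.mem_biUnion, Finset.mem_image, Finset.mem_filter,
      Finset.mem_univ, true_and, Finset.mem_offDiag]
    by_cases ha : a ∈ S
    · by_cases hb : b ∈ S
      · exact Or.inr ⟨ha, hb, hp.1.ne⟩
      · exact Or.inl (Or.inl ⟨a, ha, b, ⟨hp.1, hb⟩, rfl⟩)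
    · have hb : b ∈ S := by tauto
      exact Or.inl (Or.inr ⟨b, hb, a, ⟨hp.1.symm, ha⟩, rfl⟩)
  unfold FF
  refine le_trans (Finset.card_le_card hsub) ?_
  refine le_trans (Finset.card_union_le _ _) ?_
  rw [Finset.offDiag_card]
  refine Nat.add_le_add_right ?_ _
  refine le_trans (Finset.card_union_le _ _) ?_
  have h1 := Finset.card_biUnion_le_card_mul S (fun u => (Finset.univ.filter fun y => G.Adj u y ∧ y ∉ S).image fun y => (u, y)) d
    (fun u hu => le_trans Finset.card_image_le (h u hu))
  have h2 := Finset.card_biUnion_le_card_mul S (fun u => (Finset.univ.filter fun y => G.Adj u y ∧ y ∉ S).image fun y => (y, u)) d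
    (fun u hu => le_trans Finset.card_image_le (h u hu))
  have : S.card * (2 * d) = S.card * d + S.card * d := by ring
  omega

/-! Deletion of a vertex of small degree. -/
lemma case2del [Fintype V] {S : Finset V} {t : ℕ} {v : V} (hv : v ∈ S) (hd : dg G v + 1 ≤ t)
    (h : Good (gc G {v} v v) (S \ {v}) t) : Good G S t := by
  unfold Good at *
  have hF : FF G S ≤ FF G {v} + FF (gc G {v} v v) (S \ {v}) := by
    apply FF_le
    intro a b hab h
    rw [gc_adj]
    simp only [Finset.mem_sdiff]
    tauto
  have hF1 := FF_single (G := G) v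
  change _ ≤ 2 * dg G v at hF1
  have hc := Finset.card_sdiff_add_card_eq_card (Finset.singleton_subset_iff.2 hv)
  have hm : mm (gc G {v} v v) (S \ {v}) t ≤ mm G S t := by
    unfold mm
    apply Finset.card_le_card
    intro u hu
    simp only [Finset.mem_filter, Finset.mem_sdiff, Finset.mem_singleton] at hu ⊢
    refine ⟨hu.1.1, hu.2.trans (Finset.card_le_card ?_)⟩
    intro y hy
    simp only [Finset.mem_filter, Finset.mem_univ, true_and, Finset.mem_sdiff, gc_adj,
      Finset.mem_singleton] at hy ⊢
    obtain ⟨hy1, hy2⟩ := hy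
    grind
  simp only [Finset.card_singleton] at hc
  rw [← hc]
  have : 2 * t * ((S \ {v}).card + 1) = 2 * t * (S \ {v}).card + 2 * t := by ring
  omega

lemma del_lam {S : Finset V} {v : V} {x y : V} {n : ℕ} (hL : Lam (gc G {v} v v) (S \ {v}) x y n) :
    Lam G S x y n := by
  have hadj : ∀ a b, (gc G {v} v v).Adj a b → G.Adj a b ∧ a ≠ v := by
    intro a b h
    rw [gc_adj] at h
    simp only [Finset.mem_singleton] at h
    grind
  have key : ∀ {x y}, Lam (gc G {v} v v) (S \ {v}) x y n → x ∉ S := by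
    intro x y hL
    obtain ⟨u, hu, hxu⟩ := hL.adj
    obtain ⟨L, h1, h2, h3, h4, h5, h6⟩ := hL
    have := hadj _ _ hxu
    simp at h4
    tauto
  have hx := key hL
  have hy := key hL.symm
  obtain ⟨L, h1, h2, h3, h4, h5, h6⟩ := hL
  refine ⟨L, ⟨h1.1, h1.2.1.imp (fun a b h => (hadj a b h).1), h1.2.2⟩, h2, h3, hx, hy, ?_⟩
  intro u hu
  have := h6 u hu
  simp at this
  tauto

def Pth (G : SimpleGraph V) (S : Finset V) (x0 : V) (l : List V) (v : V) : Prop :=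
  IsP G l x0 v ∧ x0 ∉ S ∧ (∀ u ∈ l, u ≠ x0 → u ∈ S) ∧ 2 ≤ l.length

lemma Pth.ne {S : Finset V} {x0 v : V} {l : List V} (h : Pth G S x0 l v) : v ≠ x0 := by
  rintro rfl
  have := h.1.eq_of_len
  have := h.2.2.2
  omega

lemma Pth.Y [Fintype V] {S : Finset V} {t : ℕ} (hM : MM G S t) {x0 v : V} {l : List V}
    (h : Pth G S x0 l v)
    (hY : (Finset.univ.filter fun y => G.Adj v y ∧ y ∉ S ∧ y ≠ x0).Nonempty) :
    (Finset.univ.filter fun y => G.Adj v y ∧ y ∉ S ∧ y ≠ x0).card + (l.length - 1) ≤ t := by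
  have hne := h.ne
  obtain ⟨h1, h2, h3, h4⟩ := h
  have hvS : v ∈ S := h3 v h1.last_mem hne
  apply hM x0 _ _ hY
  · intro y hy
    simp only [Finset.mem_filter, Finset.mem_univ, true_and] at hy
    refine ⟨l ++ [y], h1.append (IsP.single y) hy.1 ?_, ?_, ?_, h2, hy.2.1, ?_⟩
    · intro u hu; simp; rintro rfl; exact hy.2.1 (h3 _ hu hy.2.2)
    · simp; omega
    · simp; omega
    · intro u hu
      simp at hu
      have := h3 u
      tauto
  · intro y hy y' hy' hyy
    simp only [Finset.mem_filter, Finset.mem_univ, true_and] at hy hy'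
    have hP : IsP G ([y] ++ [v]) y v := (IsP.single y).append (IsP.single v) hy.1.symm (by
      intro v hv; simp at hv ⊢; subst hv; exact hy.1.ne')
    refine ⟨[y] ++ [v] ++ [y'], hP.append (IsP.single y') hy'.1 ?_, by simp, by simp, hy.2.1, hy'.2.1, ?_⟩
    · intro u hu; simp at hu ⊢
      rcases hu with rfl | rfl
      · exact hyy
      · exact hy'.1.ne
    · intro u hu
      simp at hu
      rcases hu with rfl | rfl | rfl <;> simp [hvS]

lemma exists_max [Fintype V] {S : Finset V} (hTC : TC G S) (hS : S.Nonempty) :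
    ∃ x0 l v, Pth G S x0 l v ∧ ∀ x0' l' v', Pth G S x0' l' v' → l'.length ≤ l.length := by
  obtain ⟨u, hu, y, hy, -, huy⟩ := hTC S subset_rfl hS hS.choose
  have hex : ∃ x0 l v, Pth G S x0 l v := by
    refine ⟨y, [y] ++ [u], u, (IsP.single y).append (IsP.single u) huy.symm ?_, hy, ?_, by simp⟩
    · intro v hv; simp at hv ⊢; subst hv; exact huy.ne'
    · intro v hv hv'
      simp at hv
      rcases hv with rfl | rfl
      · exact absurd rfl hv'
      · exact hu
  let P : ℕ → Prop := fun n => ∃ x0 l v, Pth G S x0 l v ∧ l.length = n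
  have hle : ∀ n, P n → n ≤ Fintype.card V := by
    rintro n ⟨x0, l, v, h, rfl⟩
    exact h.1.1.length_le_card
  obtain ⟨x0, l, v, h⟩ := hex
  have hPn : P l.length := ⟨x0, l, v, h, rfl⟩
  obtain ⟨x1, l1, v1, h1, h2⟩ := Nat.findGreatest_spec (P := P) (hle _ hPn) hPn
  refine ⟨x1, l1, v1, h1, ?_⟩
  intro x' l' v' h'
  have hP' : P l'.length := ⟨x', l', v', h', rfl⟩
  rw [h2]
  exact Nat.le_findGreatest (hle _ hP') hP'

lemma maxp_nbr {S : Finset V} {x0 v : V} {l : List V} (h : Pth G S x0 l v)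
    (hmax : ∀ x0' l' v', Pth G S x0' l' v' → l'.length ≤ l.length) {u : V} (hu : u ∈ S)
    (hvu : G.Adj v u) : u ∈ l := by
  by_contra hul
  have := hmax x0 (l ++ [u]) u ⟨h.1.append (IsP.single u) hvu (by
    intro w hw; simp; rintro rfl; exact hul hw), h.2.1, by
      intro w hw hw'
      simp at hw
      rcases hw with hw | rfl
      · exact h.2.2.1 w hw hw'
      · exact hu, by have := h.2.2.2; simp; omega⟩
  simp at this

/-- the case where the end vertex has no further neighbour outside -/
lemma case2a [Fintype V] {S : Finset V} {t : ℕ} (hTC : TC G S) (hM : MM G S t) {x0 v : V} {l : List V}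
    (h : Pth G S x0 l v) (hmax : ∀ x0' l' v', Pth G S x0' l' v' → l'.length ≤ l.length)
    (hY : ∀ y, G.Adj v y → y ∉ S → y = x0) : dg G v + 1 ≤ t := by
  have hnb : ∀ y, G.Adj v y → y ∈ l := by
    intro y hy
    by_cases hyS : y ∈ S
    · exact maxp_nbr h hmax hyS hy
    · rw [hY y hy hyS]; exact h.1.head_mem
  have hne := h.ne
  have hvS : v ∈ S := h.2.2.1 v h.1.last_mem hne
  obtain ⟨y0, hy0⟩ : ∃ y, G.Adj v y := by
    obtain ⟨u, hu, y, hy, -, huy⟩ := hTC {v} (by simpa using hvS) (by simp) v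
    simp at hu; subst hu; exact ⟨y, huy⟩
  obtain ⟨B, p, C, hl, hp, hB⟩ := first_split (fun y => G.Adj v y) l ⟨y0, hnb y0 hy0, hy0⟩
  subst hl
  have hdg : 1 ≤ dg G v := Finset.card_pos.2 ⟨y0, by simp [hy0]⟩
  obtain ⟨hA, hPC⟩ := h.1.split
  have hnd := List.nodup_append'.1 h.1.1
  have hpC : p ∉ C := (List.nodup_cons.1 hnd.2.1).1
  have hvC : v ∈ C := by
    have := hPC.last_mem
    rcases List.mem_cons.1 this with rfl | h
    · exact absurd hp (G.loopless.1 _)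
    · exact h
  have hnbC : ∀ y, G.Adj v y → y ∈ p :: C := by
    intro y hy
    have := hnb y hy
    rw [List.mem_append] at this
    rcases this with h | h
    · exact absurd hy (hB y h)
    · exact h
  have hx0C : x0 ∉ C := by
    have := hA.head_mem
    simp at this
    rcases this with h | rfl
    · intro h'; exact hnd.2.2 h (by simp [h'])
    · exact hpC
  have hCS : ∀ u ∈ C, u ∈ S := by
    intro u hu
    apply h.2.2.1 u (by simp [hu])
    rintro rfl; exact hx0C hu
  have hK : ∀ u, u ∈ (p :: C).toFinset ↔ u = p ∨ u ∈ C := by intro u; simp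
  obtain ⟨y, hy⟩ := link hTC (dg G v + 1) (by omega) x0 h.2.1 _ (p :: C).toFinset p (B ++ [p]) rfl hA
    (by intro u hu; apply h.2.2.1; simp at hu ⊢; tauto)
    (by
      intro u hu huK
      rw [hK] at huK
      rcases huK with h | h
      · exact h
      · simp at hu
        rcases hu with h' | h'
        · exact absurd (show u ∈ p :: C by simp [h]) (fun h'' => hnd.2.2 h' h'')
        · exact h')
    (by simp) ⟨v, by rw [hK]; exact Or.inr hvC, hp.ne⟩
    (by
      intro q hq hqp
      rw [hK] at hq
      rcases hq with h | h
      · exact absurd h hqp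
      · exact hCS q h)
    (by
      intro q hq hqp ⟨z, hz, hqz⟩
      have hqv : q ≠ v := by
        rintro rfl
        exact hz (by rw [List.mem_toFinset]; exact hnbC z hqz)
      have hqC : q ∈ C := by
        rw [hK] at hq; tauto
      obtain ⟨C1, C2, rfl⟩ := List.append_of_mem hqC
      obtain ⟨E1, s, E2, hE, hs, hE2⟩ := last_split (fun y => G.Adj v y) (p :: C1) ⟨p, by simp, hp⟩
      have hPC' : IsP G ((p :: C1) ++ q :: C2) p v := by simpa using hPC
      have hq2 := hPC'.split.2
      have hmem : ∀ u, u ∈ p :: (C1 ++ q :: C2) ↔ u ∈ E1 ∨ u = s ∨ u ∈ E2 ∨ u ∈ q :: C2 := by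
        intro u
        rw [← List.cons_append, hE]
        simp only [List.mem_append, List.mem_cons]
        tauto
      rw [hE] at hPC'
      have hPC'' : IsP G (E1 ++ s :: (E2 ++ q :: C2)) p v := by simpa using hPC'
      have hL : IsP G ((E1 ++ [s]) ++ (q :: C2).reverse) p q :=
        hPC''.split.1.append hq2.reverse hs.symm (by
          intro u hu hu'
          have := (List.nodup_append'.1 hPC'.1).2.2
          refine this (a := u) ?_ (List.mem_reverse.1 hu')
          simp at hu ⊢
          tauto)
      refine ⟨_, hL, ?_, ?_⟩
      · have hsub : insert v (Finset.univ.filter fun y => G.Adj v y) ⊆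
            ((E1 ++ [s]) ++ (q :: C2).reverse).toFinset := by
          intro u hu
          rw [List.mem_toFinset]
          simp only [List.mem_append, List.mem_reverse, List.mem_singleton]
          rcases Finset.mem_insert.1 hu with rfl | hu
          · exact Or.inr hq2.last_mem
          · simp only [Finset.mem_filter, Finset.mem_univ, true_and] at hu
            have h1 := (hmem u).1 (hnbC u hu)
            have h2 := hE2 u
            tauto
        have := Finset.card_le_card hsub
        rw [List.toFinset_card_of_nodup hL.1, Finset.card_insert_of_notMem (by simp)] at this
        exact this
      · intro u hu
        rw [List.mem_toFinset, hmem]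
        simp only [List.mem_append, List.mem_reverse, List.mem_singleton] at hu
        tauto)
  have := hM.one hy
  omega

lemma case2 [Fintype V] {S : Finset V} {t : ℕ} (hTC : TC G S) (hM : MM G S t) (hS : S.Nonempty)
    (hconn : ∀ D ⊆ S, D.Nonempty → D ≠ S → ∃ u ∈ D, ∃ y ∈ S, y ∉ D ∧ G.Adj u y) :
    Good G S t ∨ ∃ v ∈ S, dg G v + 1 ≤ t := by
  obtain ⟨x0, l, v, h, hmax⟩ := exists_max hTC hS
  have hne := h.ne
  have hvl := h.1.last_mem
  have hvS : v ∈ S := h.2.2.1 v hvl hne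
  have h2 := h.2.2.2
  by_cases hY : (Finset.univ.filter fun y => G.Adj v y ∧ y ∉ S ∧ y ≠ x0).Nonempty
  swap
  · right
    refine ⟨v, hvS, case2a hTC hM h hmax ?_⟩
    intro y hy hyS
    by_contra hyx
    exact hY ⟨y, by simp [hy, hyS, hyx]⟩
  by_cases hdg : dg G v + 1 ≤ t
  · exact Or.inr ⟨v, hvS, hdg⟩
  left
  have hYc := h.Y hM hY
  have hYpos := Finset.card_pos.2 hY
  -- v is adjacent to everything on l
  have hadj : ∀ u ∈ l, u ≠ v → G.Adj v u := by
    have hsub : (Finset.univ.filter fun y => G.Adj v y) ⊆ (l.toFinset.erase v) ∪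
        (Finset.univ.filter fun y => G.Adj v y ∧ y ∉ S ∧ y ≠ x0) := by
      intro y hy
      simp only [Finset.mem_filter, Finset.mem_univ, true_and, Finset.mem_union, Finset.mem_erase,
        List.mem_toFinset] at hy ⊢
      by_cases hyS : y ∈ S
      · exact Or.inl ⟨hy.ne', maxp_nbr h hmax hyS hy⟩
      · by_cases hyx : y = x0
        · left; rw [hyx]; exact ⟨hne.symm, h.1.head_mem⟩
        · exact Or.inr ⟨hy, hyS, hyx⟩
    have hcard : ((l.toFinset.erase v) ∪
        (Finset.univ.filter fun y => G.Adj v y ∧ y ∉ S ∧ y ≠ x0)).card ≤ dg G v := by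
      refine le_trans (Finset.card_union_le _ _) ?_
      rw [Finset.card_erase_of_mem (by simpa using hvl), List.toFinset_card_of_nodup h.1.1]
      omega
    have heq := Finset.eq_of_subset_of_card_le hsub hcard
    intro u hu huv
    have : u ∈ (Finset.univ.filter fun y => G.Adj v y) := by
      rw [heq]; simp [hu, huv]
    simpa using this
  -- every vertex is an end
  have hrot : ∀ u ∈ l, u ≠ x0 → ∃ l', Pth G S x0 l' u ∧ l'.length = l.length ∧ ∀ w, w ∈ l' ↔ w ∈ l := by
    intro u hu hux
    by_cases huv : u = v
    · subst huv; exact ⟨l, h, rfl, fun _ => Iff.rfl⟩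
    obtain ⟨B, C, rfl⟩ := List.append_of_mem hu
    rcases B.eq_nil_or_concat' with rfl | ⟨B, c, rfl⟩
    · exfalso
      have := h.1.2.2.1
      simp at this
      exact hux this
    have hP : IsP G (B ++ c :: u :: C) x0 v := by simpa using h.1
    obtain ⟨s1, s2⟩ := hP.split2
    have hcv : c ≠ v := by
      rintro rfl
      have := (List.nodup_append'.1 h.1.1).2.2
      exact this (a := c) (by simp) s2.last_mem
    have hcl : c ∈ B ++ [c] ++ u :: C := by simp
    have hmm : ∀ w, w ∈ (B ++ [c]) ++ (u :: C).reverse ↔ w ∈ B ++ [c] ++ u :: C := by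
      intro w; simp only [List.mem_append, List.mem_reverse]
    refine ⟨(B ++ [c]) ++ (u :: C).reverse, ⟨s1.append s2.reverse (hadj c hcl hcv).symm ?_, h.2.1, ?_, ?_⟩, ?_, hmm⟩
    · intro w hw hw'
      have := (List.nodup_append'.1 h.1.1).2.2
      exact this hw (List.mem_reverse.1 hw')
    · intro w hw; exact h.2.2.1 w ((hmm w).1 hw)
    · simp; omega
    · simp
  have hSl : S = l.toFinset.erase x0 := by
    by_contra hneS
    obtain ⟨u, hu, y, hyS, hyD, huy⟩ := hconn (l.toFinset.erase x0) (by
      intro u hu; simp at hu; exact h.2.2.1 u hu.2 hu.1) ⟨v, by simp [hvl, hne]⟩ (Ne.symm hneS)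
    simp at hu
    obtain ⟨l', hl', hlen, hmem⟩ := hrot u hu.2 hu.1
    have := maxp_nbr hl' (by rw [hlen]; exact hmax) hyS huy
    rw [hmem] at this
    apply hyD
    simp [this]
    rintro rfl; exact h.2.1 hyS
  have hScard : S.card = l.length - 1 := by
    rw [hSl, Finset.card_erase_of_mem (by simpa using h.1.head_mem), List.toFinset_card_of_nodup h.1.1]
  have hdT : ∀ u ∈ S, dT G S u ≤ t + 1 - S.card := by
    intro u hu
    have hul : u ∈ l ∧ u ≠ x0 := by
      rw [hSl] at hu; simp at hu; exact ⟨hu.2, hu.1⟩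
    obtain ⟨l', hl', hlen, hmem⟩ := hrot u hul.1 hul.2
    have hd : dT G S u ≤ (Finset.univ.filter fun y => G.Adj u y ∧ y ∉ S ∧ y ≠ x0).card + 1 := by
      unfold dT
      rw [← Finset.card_singleton x0]
      refine le_trans (Finset.card_le_card ?_) (Finset.card_union_le _ _)
      intro y hy
      simp only [Finset.mem_filter, Finset.mem_univ, true_and, Finset.mem_union,
        Finset.mem_singleton] at hy ⊢
      tauto
    by_cases hYu : (Finset.univ.filter fun y => G.Adj u y ∧ y ∉ S ∧ y ≠ x0).Nonempty
    · have := hl'.Y hM hYu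
      omega
    · rw [Finset.not_nonempty_iff_eq_empty] at hYu
      rw [hYu] at hd
      simp at hd
      omega
  unfold Good
  by_cases hS1 : S.card = 1
  · obtain ⟨a, rfl⟩ := Finset.card_eq_one.1 hS1
    have hF := FF_bound (G := G) (S := {a}) (d := dT G {a} a) (by simp)
    have hd := hdT a (by simp)
    simp at hF hd ⊢
    by_cases hta : t ≤ dT G {a} a
    · have : mm G {a} t = 1 := by
        unfold mm
        rw [Finset.filter_true_of_mem (by simpa using hta)]; simp
      omega
    · omega
  · have hF := FF_bound hdT
    obtain ⟨c, hc⟩ : ∃ c, S.card = c + 2 := ⟨S.card - 2, by omega⟩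
    obtain ⟨e, he⟩ : ∃ e, t + 1 - S.card = e := ⟨_, rfl⟩
    have ht : t = e + c + 1 := by omega
    rw [he, hc] at hF
    rw [hc, ht]
    have e1 : (c + 2) * (c + 2) - (c + 2) = (c + 2) * (c + 1) := by
      rw [show (c + 2) * (c + 2) = (c + 2) * (c + 1) + (c + 2) by ring]; omega
    rw [e1] at hF
    nlinarith

theorem main_ind [Fintype V] : ∀ (n : ℕ) (G : SimpleGraph V) (S : Finset V) (t : ℕ), S.card = n →
    TC G S → MM G S t → Good G S t := by
  intro n
  induction n using Nat.strong_induction_on with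
  | _ n ih =>
  intro G S t hn hTC hM
  by_cases hS : S.Nonempty
  swap
  · rw [Finset.not_nonempty_iff_eq_empty] at hS
    subst hS
    simp [Good, FF]
  have hlt : ∀ D ⊆ S, D.Nonempty → (S \ D).card < n := by
    intro D hD hDne
    have := Finset.card_sdiff_add_card_eq_card hD
    have := Finset.card_pos.2 hDne
    omega
  have hlt' : ∀ D ⊆ S, D ≠ S → D.card < n := by
    intro D hD hDne
    rw [← hn]
    exact Finset.card_lt_card (Finset.ssubset_iff_subset_ne.2 ⟨hD, hDne⟩)
  by_cases hconn : ∀ D ⊆ S, D.Nonempty → D ≠ S → ∃ u ∈ D, ∃ y ∈ S, y ∉ D ∧ G.Adj u y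
  swap
  · push Not at hconn
    obtain ⟨D, hD, hDne, hDS, hno⟩ := hconn
    refine case0 hD hno ?_ ?_
    · exact ih _ (hlt' D hD hDS) G D t rfl (hTC.subset hD) (hM.comp hD hno)
    · refine ih _ (hlt D hD hDne) G (S \ D) t rfl (hTC.subset Finset.sdiff_subset)
        (hM.comp Finset.sdiff_subset ?_)
      intro u hu y hy hyD huy
      simp only [Finset.mem_sdiff] at hu hyD
      exact hno y (by tauto) u hu.1 hu.2 huy.symm
  by_cases hcut : ∃ D ⊆ S, D.Nonempty ∧ D ≠ S ∧ ∃ z w,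
      ∀ u ∈ D, ∀ y, G.Adj u y → y ∈ D ∨ y = z ∨ y = w
  · obtain ⟨D, hD, hDne, hDS, z, w, hN⟩ := hcut
    have hwlog : ∃ z w, w ∈ S ∧ w ∉ D ∧ z ∉ D ∧ ∀ u ∈ D, ∀ y, G.Adj u y → y ∈ D ∨ y = z ∨ y = w := by
      obtain ⟨u, hu, y, hyS, hyD, huy⟩ := hconn D hD hDne hDS
      obtain ⟨u', hu', y', hyD', hne, huy'⟩ := hTC D hD hDne y
      have h1 := hN u hu y huy
      have h2 := hN u' hu' y' huy'
      refine ⟨y', y, hyS, hyD, hyD', ?_⟩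
      intro a ha b hb
      have := hN a ha b hb
      grind
    obtain ⟨z, w, hwS, hwD, hzD, hN⟩ := hwlog
    have hd := dpath (hTC.subset hD) hDne hzD hN
    refine case1 (z := z) (w := w) hD hDne hTC hwS hwD ?_ ?_
    · exact ih _ (hlt' D hD hDS) G D (t - 1) rfl (hTC.subset hD) (hM.cut hTC hD hN (Or.inr hwS))
    · exact ih _ (hlt D hD hDne) _ (S \ D) t rfl (gc_TC hTC hD hN)
        (hM.mono (fun x y n => gc_lam hD hd))
  push Not at hcut
  rcases case2 hTC hM hS hconn with h | ⟨v, hv, hdg⟩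
  · exact h
  · refine case2del hv hdg (ih _ (hlt {v} (by simpa using hv) (by simp)) _ _ t rfl ?_
      (hM.mono (fun x y n => del_lam)))
    intro D hD hDne z
    have hDv : v ∉ D := fun h => by have := hD h; simp at this
    obtain ⟨u, hu, y, huy, hyD, hyz, hyv⟩ := hcut D (hD.trans Finset.sdiff_subset) hDne
      (by rintro rfl; exact hDv hv) z v
    refine ⟨u, hu, y, hyD, hyz, gc_adj.2 (Or.inl ⟨huy, ?_, ?_⟩)⟩
    · simp; rintro rfl; exact hDv hu
    · simpa using hyv

end
end Stmt11

namespace Stmt11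
section
open scoped Classical
variable {V : Type*} {G : SimpleGraph V}

lemma IsP.toWalk : ∀ (L : List V) (a b : V), IsP G L a b → ∃ p : G.Walk a b, p.support = L
  | [], a, b, h => absurd rfl h.ne_nil
  | [x], a, b, h => by
    have h1 : x = a := by simpa using h.2.2.1
    have h2 : x = b := by simpa using h.2.2.2
    subst h1; subst h2
    exact ⟨Walk.nil, rfl⟩
  | x :: y :: L, a, b, h => by
    have h1 : x = a := by simpa using h.2.2.1
    subst h1
    have h' : IsP G ([] ++ x :: y :: L) x b := h
    obtain ⟨p, hp⟩ := IsP.toWalk (y :: L) y b h'.split2.2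
    exact ⟨Walk.cons h'.adj_mid p, by simp [hp]⟩

lemma close {c : ℕ} (hc : ∀ (x : V) (w' : G.Walk x x), w'.IsCycle → w'.length ≤ c)
    {L : List V} {a b : V} (h : IsP G L a b) (h3 : 3 ≤ L.length) (hab : G.Adj b a) :
    L.length ≤ c := by
  obtain ⟨p, hp⟩ := IsP.toWalk L a b h
  have hl : p.length + 1 = L.length := by rw [← hp]; simp
  have hpp : p.IsPath := by rw [Walk.isPath_def, hp]; exact h.1
  have : (Walk.cons hab p).IsCycle := by
    rw [Walk.isCycle_iff_isPath_tail_and_le_length]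
    refine ⟨by simpa using hpp, by simp; omega⟩
  have := hc _ _ this
  simp at this
  omega

lemma cycList {v : V} (w : G.Walk v v) (hw : w.IsCycle) {x : V} (hx : x ∈ w.support) :
    ∃ L z, IsP G L x z ∧ G.Adj z x ∧ L.length = w.length ∧ ∀ u, u ∈ L ↔ u ∈ w.support := by
  have hr := hw.rotate hx
  have hm : ∀ u, u ∈ (w.rotate x hx).support ↔ u ∈ w.support := by
    intro u
    exact Walk.mem_support_rotate_iff w x hx
  have hl : (w.rotate x hx).length = w.length := by simp
  generalize w.rotate x hx = w' at hr hm hl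
  cases w' with
  | nil => simp at hr
  | @cons _ z _ h p =>
    have hp := ((Walk.cons_isCycle_iff _ _).1 hr).1
    refine ⟨p.support.reverse, z, ⟨?_, ?_, ?_, ?_⟩, h.symm, ?_, ?_⟩
    · simpa using hp.support_nodup
    · rw [List.isChain_reverse]
      exact p.isChain_adj_support.imp (fun _ _ h => h.symm)
    · simp [List.getLast?_eq_some_getLast]
    · simp [List.head?_eq_some_head]
    · simp at hl ⊢; omega
    · intro u
      rw [← hm]
      simp
      rintro rfl
      exact p.end_mem_support

lemma getsplit (L : List V) (i : ℕ) (h : i < L.length) :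
    L = L.take i ++ L[i] :: L.drop (i + 1) := by simp

lemma cyc_MM {v : V} (w : G.Walk v v) (hw : w.IsCycle) {t : ℕ} (hlen : w.length = 2 * t)
    (hc : ∀ (x : V) (w' : G.Walk x x), w'.IsCycle → w'.length ≤ 2 * t)
    (S : Finset V) (hS : ∀ x, x ∈ S ↔ x ∉ w.support) : MM G S t := by
  intro x0 Y n hY h1 h2
  have hx0 : x0 ∈ w.support := by
    obtain ⟨y, hy⟩ := hY
    obtain ⟨L, _, _, _, h4, _⟩ := h1 y hy
    rw [hS] at h4; tauto
  obtain ⟨L, z, hL, hz, hLl, hLm⟩ := cycList w hw hx0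
  rw [hlen] at hLl
  have hLS : ∀ u, u ∈ L ↔ u ∉ S := by intro u; rw [hLm, hS]; tauto
  have hpos : ∀ y n, Lam G S x0 y n → n + 1 ≤ L.idxOf y ∧ L.idxOf y + n + 1 ≤ 2 * t ∧
      2 ≤ L.idxOf y ∧ L.idxOf y + 2 ≤ 2 * t := by
    intro y n hy
    have hne := hy.ne
    obtain ⟨P, p1, p2, p3, p4, p5, p6⟩ := hy
    have hyL : y ∈ L := (hLS y).2 p5
    have hi := List.idxOf_lt_length_iff.2 hyL
    have hsp := getsplit L _ hi
    rw [List.getElem_idxOf] at hsp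
    have hAl : (L.take (L.idxOf y)).length = L.idxOf y := by simp; omega
    generalize L.idxOf y = i at *
    generalize L.take i = A at *
    generalize L.drop (i+1) = D at *
    subst hsp
    have hA : A ≠ [] := by
      rintro rfl
      have := hL.2.2.1
      simp at this
      exact hne this.symm
    obtain ⟨A', b, rfl⟩ := A.eq_nil_or_concat'.resolve_left hA
    have hL' : IsP G (A' ++ b :: y :: D) x0 z := by simpa using hL
    have hnd := hL'.1
    obtain ⟨N, n1, n2, n3⟩ := p1.join hL.split.2 (by
      intro u hu hu'
      rcases p6 u hu with h | h | h
      · exact absurd h ((hLS u).1 (by simp at hu' ⊢; tauto))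
      · subst h
        exfalso
        have h5 := hL'.split2.1.head_mem
        have := hL.1
        rw [List.nodup_append'] at this
        exact this.2.2 h5 hu'
      · exact h)
    have c1 := close hc n1 (by simp at n2; omega) hz
    obtain ⟨N', m1, m2, m3⟩ := p1.reverse.join hL'.split2.1 (by
      intro u hu hu'
      rcases p6 u (by simpa using hu) with h | h | h
      · exact absurd h ((hLS u).1 (by simp at hu' ⊢; tauto))
      · exact h
      · subst h
        exfalso
        have := hL.1
        rw [List.nodup_append'] at this
        exact this.2.2 hu' (by simp))
    have c2 := close hc m1 (by simp at m2; omega) hL'.adj_mid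
    simp at hLl hAl n2 m2
    omega
  have hgap : ∀ y y', Lam G S y y' 1 → L.idxOf y' ≠ L.idxOf y + 1 := by
    intro y y' hy hi'
    have hne := hy.ne
    obtain ⟨P, p1, p2, p3, p4, p5, p6⟩ := hy
    have hyL : y ∈ L := (hLS y).2 p4
    have hyL' : y' ∈ L := (hLS y').2 p5
    have hi := List.idxOf_lt_length_iff.2 hyL
    have hi2 := List.idxOf_lt_length_iff.2 hyL'
    have e1 : L[L.idxOf y] = y := List.getElem_idxOf hi
    have e2 : L[L.idxOf y'] = y' := List.getElem_idxOf hi2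
    have hsp : L = L.take (L.idxOf y) ++ y :: y' :: L.drop (L.idxOf y + 2) := by
      conv_lhs => rw [getsplit L _ hi, List.drop_eq_getElem_cons (by omega : L.idxOf y + 1 < L.length)]
      simp only [← hi', e1, e2]
      simp [hi']
    generalize L.take (L.idxOf y) = A at hsp
    generalize L.drop (L.idxOf y + 2) = D at hsp
    clear hi' hi hi2 e1 e2
    subst hsp
    have hnd := hL.1
    rw [List.nodup_append'] at hnd
    obtain ⟨N, n1, n2, n3⟩ := hL.split2.1.join p1 (by
      intro u hu hu'
      rcases p6 u hu' with h | h | h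
      · exact absurd h ((hLS u).1 (by simp at hu ⊢; tauto))
      · exact h
      · subst h
        exfalso
        simp at hu
        rcases hu with hu | hu
        · exact hnd.2.2 hu (by simp)
        · exact hne hu.symm)
    obtain ⟨N', m1, m2, m3⟩ := n1.join hL.split2.2 (by
      intro u hu hu'
      rcases (n3 u).1 hu with h | h
      · exfalso
        simp only [List.mem_append, List.mem_singleton] at h
        rcases h with h | h
        · exact hnd.2.2 h (List.mem_cons_of_mem _ hu')
        · subst h
          exact (List.nodup_cons.1 hnd.2.1).1 hu'
      · rcases p6 u h with h | h | h
        · exact absurd h ((hLS u).1 (by simp at hu' ⊢; tauto))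
        · subst h
          exact absurd hu' (List.nodup_cons.1 hnd.2.1).1
        · exact h)
    simp at hLl n2 m2
    have := close hc m1 (by omega) hz
    omega
  have hcard : Y.card ≤ (Finset.range (t - max n 1)).card := by
    refine Finset.card_le_card_of_injOn (fun y => (L.idxOf y - (max n 1 + 1)) / 2) ?_ ?_
    · intro y hy
      have := hpos y n (h1 y hy)
      simp
      omega
    · intro y hy y' hy' he
      by_contra hne
      have a1 := hpos y n (h1 y hy)
      have a2 := hpos y' n (h1 y' hy')
      have b1 := hgap y y' (h2 y hy y' hy' hne)
      have b2 := hgap y' y (h2 y' hy' y hy (Ne.symm hne))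
      have b3 : L.idxOf y ≠ L.idxOf y' := by
        intro h
        obtain ⟨_, _, _, _, _, p5, _⟩ := h1 y hy
        exact hne ((List.idxOf_inj ((hLS y).2 p5)).1 h)
      simp only at he
      omega
  simp at hcard
  have := Finset.card_pos.2 hY
  omega

lemma conn_cross {W : Type*} {H : SimpleGraph W} (hH : H.Connected) (D : Set W) {a b : W}
    (ha : a ∈ D) (hb : b ∉ D) : ∃ u ∈ D, ∃ y, y ∉ D ∧ H.Adj u y := by
  obtain ⟨p⟩ := hH.preconnected a b
  obtain ⟨d, _, h1, h2⟩ := p.exists_boundary_dart D ha hb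
  exact ⟨d.fst, h1, d.snd, h2, d.adj⟩

lemma cyc_TC [Fintype V] (hG : TwoConnected G) {v : V} (w : G.Walk v v) (hw : w.IsCycle)
    (S : Finset V) (hS : ∀ x, x ∈ S ↔ x ∉ w.support) : TC G S := by
  intro D hD hDne z
  obtain ⟨d, hd⟩ := hDne
  obtain ⟨_, hc, hc2⟩ := hG
  by_cases hz : z ∈ D
  · obtain ⟨u, hu, y, hy, huy⟩ := conn_cross hc (D : Set V) (a := d) (b := v) hd
      (fun h => (hS v).1 (hD h) w.start_mem_support)
    exact ⟨u, hu, y, hy, by rintro rfl; exact hy hz, huy⟩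
  · obtain ⟨x, hx, hxz⟩ : ∃ x ∈ w.support, x ≠ z := by
      by_cases hvz : v = z
      · subst hvz
        exact ⟨w.snd, w.getVert_mem_support 1, (w.adj_snd hw.not_nil).ne'⟩
      · exact ⟨v, w.start_mem_support, hvz⟩
    obtain ⟨u, hu, y, hy, huy⟩ := conn_cross (hc2 z) {p | (p : V) ∈ D}
      (a := ⟨d, by simp; rintro rfl; exact hz hd⟩) (b := ⟨x, by simpa using hxz⟩) hd
      (fun h => (hS x).1 (hD h) hx)
    exact ⟨u, hu, y, hy, y.2, by simpa using huy⟩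

lemma count [Fintype V] (S : Finset V) (T : Set V) (hT : ∀ x, x ∈ S ↔ x ∉ T) :
    2 * edgeCount G ≤ 2 * edgesWithin G T + FF G S := by
  let H : SimpleGraph V :=
    { Adj := fun a b => G.Adj a b ∧ (a ∈ S ∨ b ∈ S)
      symm := ⟨fun a b h => ⟨h.1.symm, h.2.symm⟩⟩
      loopless := ⟨fun a h => h.1.ne rfl⟩ }
  have h1 : edgeCount G ≤ edgesWithin G T + H.edgeSet.ncard := by
    unfold edgeCount edgesWithin
    refine le_trans (Set.ncard_le_ncard ?_ (Set.toFinite _)) (Set.ncard_union_le _ _)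
    intro e he
    induction e with
    | _ a b =>
    simp only [Set.mem_union, Set.mem_ofPred_eq, Sym2.mem_iff, mem_edgeSet] at he ⊢
    by_cases h : a ∈ T ∧ b ∈ T
    · left
      refine ⟨he, ?_⟩
      rintro x (rfl | rfl)
      · exact h.1
      · exact h.2
    · right
      refine ⟨he, ?_⟩
      rw [hT, hT]; tauto
  have h2 : 2 * H.edgeSet.ncard = FF G S := by
    have := H.sum_degrees_eq_twice_card_edges
    rw [Set.ncard_eq_toFinset_card', ← SimpleGraph.edgeFinset, ← this]
    unfold FF
    rw [Finset.card_filter, Fintype.sum_prod_type]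
    refine Finset.sum_congr rfl fun a _ => ?_
    rw [← Finset.card_filter, ← card_neighborFinset_eq_degree]
    congr 1
    ext b
    simp [H]
  omega

lemma dT_le [Fintype V] {S : Finset V} {t : ℕ} (hM : MM G S t) (ht : 1 ≤ t) {u : V} (hu : u ∈ S) :
    dT G S u ≤ t := by
  unfold dT
  set N := Finset.univ.filter fun y : V => G.Adj u y ∧ y ∉ S with hN
  by_contra hlt
  push Not at hlt
  have hL : ∀ x ∈ N, ∀ y ∈ N, x ≠ y → Lam G S x y 1 := by
    intro x hx y hy hne
    simp [hN] at hx hy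
    refine ⟨[x, u, y], ⟨?_, ?_, by simp, by simp⟩, by simp, by simp, hx.2, hy.2, ?_⟩
    · simp [hx.1.ne', hy.1.ne, hne]
    · simp [hx.1.symm, hy.1]
    · simp [hu]
  obtain ⟨x0, hx0⟩ : N.Nonempty := Finset.card_pos.1 (by omega)
  have hc := Finset.card_erase_of_mem hx0
  have := hM x0 (N.erase x0) 1 (Finset.card_pos.1 (by omega))
    (fun y hy => hL x0 hx0 y (Finset.mem_of_mem_erase hy) (Finset.ne_of_mem_erase hy).symm)
    (fun y hy y' hy' hne => hL y (Finset.mem_of_mem_erase hy) y' (Finset.mem_of_mem_erase hy') hne)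
  omega

end
end Stmt11

/-- Edge bound when the longest cycle has length `c = k−2`, `k ≥ 6` even: for
`t = (k-2)/2`, a 2-connected `𝓒_{≥k}`-free graph `G` with longest cycle `C` of
length `k−2 ≤ n−1` satisfies
`e(G) ≤ e(G[C]) + t·m + (t − 1/2)(n − c − m)`, where `m = |A_{⌊c/2⌋}|`. -/
theorem stmt11 {V : Type*} [Fintype V] (k : ℕ) (hk : 6 ≤ k) (hkeven : Even k)
    (G : SimpleGraph V) (hG2 : TwoConnected G) (hGk : ¬ HasCycleGE G k)
    (v : V) (w : G.Walk v v) (hw : w.IsCycle) (hlen : w.length = k - 2)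
    (hlongest : ∀ (x : V) (w' : G.Walk x x), w'.IsCycle → w'.length ≤ k - 2)
    (hcn : k - 2 + 1 ≤ Fintype.card V) :
    (edgeCount G : ℝ)
      ≤ (edgesWithin G {x | x ∈ w.support} : ℝ)
        + (↑((k - 2) / 2) : ℝ)
          * (↑({u | u ∉ w.support ∧
              degOn G {x | x ∈ w.support} u = (k - 2) / 2}.ncard) : ℝ)
        + ((↑((k - 2) / 2) : ℝ) - 1 / 2)
          * ((Fintype.card V : ℝ) - ((k : ℝ) - 2)
            - (↑({u | u ∉ w.support ∧
                degOn G {x | x ∈ w.support} u = (k - 2) / 2}.ncard) : ℝ)) := by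
  
  classical
  obtain ⟨j, hj⟩ := hkeven
  obtain ⟨t, rfl⟩ : ∃ t, k = 2 * t + 2 := ⟨j - 1, by omega⟩
  have ht : (2 * t + 2 - 2) / 2 = t := by omega
  have ht' : 2 * t + 2 - 2 = 2 * t := by omega
  rw [ht]
  rw [ht'] at hlen hlongest hcn
  set S : Finset V := Finset.univ.filter fun x => x ∉ w.support with hSdef
  have hS : ∀ x, x ∈ S ↔ x ∉ w.support := by intro x; simp [hSdef]
  have hM : Stmt11.MM G S t := Stmt11.cyc_MM w hw hlen hlongest S hS
  have hTC : Stmt11.TC G S := Stmt11.cyc_TC hG2 w hw S hS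
  have hgood := Stmt11.main_ind _ G S t rfl hTC hM
  unfold Stmt11.Good at hgood
  have hcount := Stmt11.count (G := G) S {x | x ∈ w.support} (by intro x; simp [hSdef])
  have hdeg : ∀ u, degOn G {x | x ∈ w.support} u = Stmt11.dT G S u := by
    intro u
    unfold degOn Stmt11.dT
    rw [Set.ncard_eq_toFinset_card']
    congr 1
    ext x
    simp [hSdef]
    tauto
  have hmm : Stmt11.mm G S t
      = {u | u ∉ w.support ∧ degOn G {x | x ∈ w.support} u = t}.ncard := by
    unfold Stmt11.mm
    rw [Set.ncard_eq_toFinset_card']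
    congr 1
    ext u
    simp only [Finset.mem_filter, Set.mem_toFinset, Set.mem_ofPred_eq, hdeg, hS]
    constructor
    · rintro ⟨h1, h2⟩
      exact ⟨h1, le_antisymm (Stmt11.dT_le hM (by omega) ((hS u).2 h1)) h2⟩
    · rintro ⟨h1, h2⟩
      exact ⟨h1, h2.ge⟩
  rw [← hmm]
  have hScard : S.card + 2 * t = Fintype.card V := by
    obtain ⟨L, z, hL, _, hLl, hLm⟩ := Stmt11.cycList w hw w.start_mem_support
    have h1 : L.toFinset = Sᶜ := by
      ext x; simp [hSdef, hLm]
    have h2 := List.toFinset_card_of_nodup hL.1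
    rw [h1, Finset.card_compl, hLl, hlen] at h2
    have := Finset.card_le_univ S
    omega
  have hScard' : (S.card : ℝ) + 2 * t = Fintype.card V := by exact_mod_cast hScard
  have hfin : 2 * edgeCount G + S.card ≤
      2 * edgesWithin G {x | x ∈ w.support} + (2 * t * S.card + Stmt11.mm G S t) := by omega
  have hfin' : 2 * (edgeCount G : ℝ) + S.card ≤
      2 * edgesWithin G {x | x ∈ w.support} + (2 * t * S.card + Stmt11.mm G S t) := by
    exact_mod_cast hfin
  have he : (Fintype.card V : ℝ) - (((2 * t + 2 : ℕ) : ℝ) - 2) = S.card := by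
    rw [← hScard']; push_cast; ring
  rw [he]
  nlinarith [hfin']
end

section
/- Let k ≥ 5 and t = ⌊(k-1)/2⌋. Let G be a 2-connected graph on n vertices containing no cycle of length ≥ k, and let C be a longest cycle of G of length c. If either c ≤ k−3, or c = k−2 with k odd, then e(G) ≤ (t − 1/2)(n − 1). -/
open SimpleGraph

namespace EG
variable {V : Type*}

/-- `l` is a path of `G` inside `S`. -/
def PathIn (G : SimpleGraph V) (S : Finset V) (l : List V) : Prop :=
  l.Nodup ∧ l.IsChain G.Adj ∧ ∀ x ∈ l, x ∈ S

theorem path_cycle (G : SimpleGraph V) (c : ℕ)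
    (hl : ∀ (x : V) (w' : G.Walk x x), w'.IsCycle → w'.length ≤ c)
    (a z : V) (p : G.Walk a z) (hp : p.IsPath) (h : G.Adj z a) (h2 : 2 ≤ p.length) :
    p.length + 1 ≤ c := by
  have := hl z (SimpleGraph.Walk.cons h p) ?_
  · simpa using this
  · rw [SimpleGraph.Walk.cons_isCycle_iff]
    refine ⟨hp, fun hmem => ?_⟩
    have := hp.length_eq_one_of_mem_edges (Sym2.eq_swap ▸ hmem)
    omega

theorem list_cycle (G : SimpleGraph V) (c : ℕ) (hc : 2 ≤ c)
    (hl : ∀ (x : V) (w' : G.Walk x x), w'.IsCycle → w'.length ≤ c)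
    (a z : V) (A : List V) (hn : (a :: A ++ [z]).Nodup)
    (hch : (a :: A ++ [z]).IsChain G.Adj) (h : G.Adj a z) :
    A.length + 2 ≤ c := by
  rcases Nat.eq_zero_or_pos A.length with h0 | h0
  · omega
  have hne : (a :: A ++ [z]) ≠ [] := by simp
  have h1 : (a :: A ++ [z]).head hne = a := by simp
  have h2 : (a :: A ++ [z]).getLast hne = z := by simp
  have h3 := SimpleGraph.Walk.length_ofSupport hne hch
  have := path_cycle G c hl _ _ (SimpleGraph.Walk.ofSupport _ hne hch)
    (by rw [SimpleGraph.Walk.isPath_def, SimpleGraph.Walk.support_ofSupport]; exact hn)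
    (by rw [h1, h2]; exact h.symm) (by rw [h3]; simp; omega)
  rw [h3] at this
  simp at this
  omega

theorem rotate {G : SimpleGraph V} {S : Finset V} {x p y : V} {T T1 T2 B : List V} {z : V}
    (hP : PathIn G S (x :: T ++ z :: B)) (h : G.Adj x y)
    (he : x :: T ++ [z] = T1 ++ p :: y :: T2) :
    ∃ T', (p :: T').Perm (x :: T) ∧ PathIn G S (p :: T' ++ z :: B) := by
  obtain ⟨R, hR⟩ : ∃ R, y :: T2 = R ++ [z] := by
    refine ⟨(y :: T2).dropLast, ?_⟩
    have h1 : (x :: T ++ [z]).getLast (by simp) = z := by simp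
    have h2 : (y :: T2).getLast (by simp) = z := by
      rw [← h1]; simp only [he]; simp
    conv_rhs => rw [← h2]
    rw [List.dropLast_append_getLast]
  have hxT : x :: T = T1 ++ p :: R := by
    have : x :: T ++ [z] = (T1 ++ p :: R) ++ [z] := by rw [he, hR]; simp
    exact List.append_cancel_right this
  have hperm : (p :: (T1.reverse ++ R)).Perm (x :: T) := by
    rw [hxT]
    refine List.Perm.trans ?_ List.perm_middle.symm
    exact ((List.reverse_perm T1).append_right R).cons p
  refine ⟨T1.reverse ++ R, hperm, ?_⟩
  have hperm2 : (p :: (T1.reverse ++ R) ++ z :: B).Perm (x :: T ++ z :: B) :=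
    hperm.append_right _
  refine ⟨hperm2.nodup_iff.2 hP.1, ?_, fun u hu => hP.2.2 u (hperm2.subset hu)⟩
  have hch := hP.2.1
  have e1 : x :: T ++ z :: B = (T1 ++ [p]) ++ (y :: T2 ++ B) := by
    rw [hR, hxT]; simp
  have e2 : p :: (T1.reverse ++ R) ++ z :: B = (T1 ++ [p]).reverse ++ (y :: T2 ++ B) := by
    rw [hR]; simp
  rw [e1] at hch
  rw [e2]
  have hhead : (T1 ++ [p]).head? = some x := by
    cases T1 with
    | nil => simp at hxT ⊢; exact hxT.1.symm
    | cons u U => simp at hxT ⊢; exact hxT.1.symm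
  rw [List.isChain_append] at hch ⊢
  refine ⟨?_, hch.2.1, ?_⟩
  · rw [List.isChain_reverse]
    exact hch.1.imp (fun _ _ h => h.symm)
  · intro u hu v hv
    rw [List.getLast?_reverse, hhead] at hu
    simp at hu hv
    subst hu; subst hv; exact h

theorem pred_unique {M T1 T2 T1' T2' : List V} {p y y' : V} (hn : M.Nodup)
    (h : M = T1 ++ p :: y :: T2) (h' : M = T1' ++ p :: y' :: T2') : y = y' := by
  have e : T1.length = T1'.length := by
    have a1 : M[T1.length]? = some p := by rw [h]; simp
    have a2 : M[T1'.length]? = some p := by rw [h']; simp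
    have hlt : T1.length < M.length := by rw [h]; simp
    exact (List.getElem?_inj hlt hn).1 (a1.trans a2.symm)
  have := (List.append_inj (h.symm.trans h') e).2
  simp at this
  exact this.1

theorem exists_pred {x z y : V} {T : List V} (hy : y ∈ T ++ [z]) :
    ∃ p T1 T2, x :: T ++ [z] = T1 ++ p :: y :: T2 := by
  obtain ⟨U, W, hUW⟩ := List.append_of_mem hy
  have hne : x :: U ≠ [] := by simp
  refine ⟨(x :: U).getLast hne, (x :: U).dropLast, W, ?_⟩
  have : (x :: U).dropLast ++ (x :: U).getLast hne :: y :: W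
      = ((x :: U).dropLast ++ [(x :: U).getLast hne]) ++ y :: W := by simp
  rw [this, List.dropLast_append_getLast, List.cons_append, hUW]; rfl

open Classical in
/-- The key lemma: a set `L` whose deletion removes few edges. -/
theorem key (G : SimpleGraph V) (c : ℕ) (hc : 2 ≤ c)
    (hl : ∀ (x : V) (w' : G.Walk x x), w'.IsCycle → w'.length ≤ c)
    (S : Finset V) (a b : V) (ha : a ∈ S) (hb : b ∈ S) (hab : G.Adj a b) :
    ∃ L ⊆ S, L.Nonempty ∧ (S \ L).Nonempty ∧ ∀ x ∈ L,
      (S.filter (G.Adj x)).card + ((S \ L).filter (G.Adj x)).card ≤ c := by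
  let Q : ℕ → ℕ → Prop := fun m s => ∃ x T z B, PathIn G S (x :: T ++ z :: B) ∧ G.Adj x z ∧
    (x :: T ++ z :: B).length = m ∧ T.length = s
  have hbd : ∀ m s, Q m s → m ≤ S.card ∧ s ≤ S.card := by
    rintro m s ⟨x, T, z, B, hP, -, rfl, rfl⟩
    have : (x :: T ++ z :: B).length ≤ S.card := by
      rw [← List.toFinset_card_of_nodup hP.1]
      exact Finset.card_le_card (fun u hu => hP.2.2 u (List.mem_toFinset.1 hu))
    refine ⟨this, ?_⟩
    simp at this; omega
  have hQ0 : ∃ m s, Q m s := ⟨2, 0, a, [], b, [], by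
    refine ⟨⟨by simp [hab.ne], by simp [hab], by simp [ha, hb]⟩, hab, rfl, rfl⟩⟩
  obtain ⟨m, ⟨s0, hm0⟩, hmax⟩ : ∃ m, (∃ s, Q m s) ∧ ∀ m' s', Q m' s' → m' ≤ m := by
    obtain ⟨m0, s0, h0⟩ := hQ0
    refine ⟨Nat.findGreatest (fun m => ∃ s, Q m s) S.card,
      Nat.findGreatest_spec (P := fun m => ∃ s, Q m s) (hbd _ _ h0).1 ⟨s0, h0⟩, ?_⟩
    intro m' s' h'
    exact Nat.le_findGreatest (P := fun m => ∃ s, Q m s) (hbd _ _ h').1 ⟨s', h'⟩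
  obtain ⟨s, hs, hsmax⟩ : ∃ s, Q m s ∧ ∀ s', Q m s' → s' ≤ s := by
    refine ⟨Nat.findGreatest (Q m) S.card, Nat.findGreatest_spec (hbd _ _ hm0).2 hm0, ?_⟩
    intro s' h'
    exact Nat.le_findGreatest (hbd _ _ h').2 h'
  obtain ⟨x0, T0, z, B, hP0, hxz, hm, hs'⟩ := hs
  have hsc : s + 2 ≤ c := by
    rw [← hs']
    have e : x0 :: T0 ++ z :: B = (x0 :: T0 ++ [z]) ++ B := by simp
    have hP1 := hP0
    rw [e] at hP1
    exact list_cycle G c hc hl x0 z T0 (List.nodup_append.1 hP1.1).1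
      (List.isChain_append.1 hP1.2.1).1 hxz
  let L := S.filter (fun x => ∃ T, (x :: T).Perm (x0 :: T0) ∧ PathIn G S (x :: T ++ z :: B))
  let W := (x0 :: T0 ++ [z]).toFinset
  have hWcard : W.card ≤ c := by
    refine (List.toFinset_card_le _).trans ?_
    simp; omega
  have hLW : L ⊆ W := by
    intro x hx
    obtain ⟨-, T, hT, -⟩ := Finset.mem_filter.1 hx
    have : x ∈ x0 :: T0 := hT.subset (by simp)
    exact List.mem_toFinset.2 (List.mem_append_left _ this)
  have hzS : z ∈ S := hP0.2.2 z (by simp)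
  have hzL : z ∉ L := by
    intro hz
    obtain ⟨-, T, -, hT⟩ := Finset.mem_filter.1 hz
    have := hT.1
    simp at this
  have hNW : ∀ x T, (x :: T).Perm (x0 :: T0) → PathIn G S (x :: T ++ z :: B) →
      ∀ y ∈ S, G.Adj x y → y ∈ T ++ [z] := by
    intro x T hT hP y hy hxy
    have hlen : T.length = T0.length := by simpa using hT.length_eq
    have hm' : (x :: T ++ z :: B).length = m := by rw [← hm]; simp [hlen]
    by_contra hcon
    by_cases hyB : y ∈ B
    · obtain ⟨B1, B2, rfl⟩ := List.append_of_mem hyB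
      have := hsmax (T ++ z :: B1).length ⟨x, T ++ z :: B1, y, B2, by simpa using hP, hxy,
        by rw [← hm']; simp, rfl⟩
      simp at this; omega
    · have hy' : y ∉ x :: T ++ z :: B := by
        simp at hcon ⊢
        exact ⟨hxy.ne', hcon.1, hcon.2, hyB⟩
      have := hmax (m + 1) 0 ⟨y, [], x, T ++ z :: B, ⟨?_, ?_, ?_⟩, hxy.symm, ?_, rfl⟩
      · omega
      · exact List.nodup_cons.2 ⟨hy', hP.1⟩
      · exact List.IsChain.cons_cons hxy.symm hP.2.1
      · intro u hu
        rcases List.mem_cons.1 hu with rfl | hu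
        · exact hy
        · exact hP.2.2 u hu
      · rw [← hm']; simp
  refine ⟨L, Finset.filter_subset _ _, ⟨x0, Finset.mem_filter.2
    ⟨hP0.2.2 x0 (by simp), T0, List.Perm.refl _, hP0⟩⟩, ⟨z, by simp [hzS, hzL]⟩, ?_⟩
  intro x hx
  obtain ⟨-, T, hT, hP⟩ := Finset.mem_filter.1 hx
  have h1 : (S.filter (G.Adj x)).card ≤ L.card := by
    have hex : ∀ y ∈ S.filter (G.Adj x), ∃ p ∈ L, ∃ T1 T2,
        x :: T ++ [z] = T1 ++ p :: y :: T2 := by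
      intro y hy
      obtain ⟨hyS, hxy⟩ := Finset.mem_filter.1 hy
      obtain ⟨p, T1, T2, he⟩ := exists_pred (x := x) (hNW x T hT hP y hyS hxy)
      obtain ⟨T', hT', hP'⟩ := rotate hP hxy he
      exact ⟨p, Finset.mem_filter.2 ⟨hP'.2.2 p (by simp), T', hT'.trans hT, hP'⟩, T1, T2, he⟩
    choose! f hfL hf using hex
    refine Finset.card_le_card_of_injOn f hfL ?_
    intro y hy y' hy' hff
    obtain ⟨T1, T2, e⟩ := hf y hy
    obtain ⟨T1', T2', e'⟩ := hf y' hy'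
    rw [← hff] at e'
    refine pred_unique ?_ e e'
    have e : x :: T ++ z :: B = (x :: T ++ [z]) ++ B := by simp
    have := hP.1
    rw [e] at this
    exact (List.nodup_append.1 this).1
  have h2 : ((S \ L).filter (G.Adj x)).card ≤ (W \ L).card := by
    refine Finset.card_le_card ?_
    intro y hy
    simp only [Finset.mem_filter, Finset.mem_sdiff] at hy ⊢
    refine ⟨?_, hy.1.2⟩
    have := hNW x T hT hP y hy.1.1 hy.2
    have hsub : y ∈ x :: T ++ [z] := List.mem_cons_of_mem _ this
    exact List.mem_toFinset.2 ((hT.append_right [z]).subset hsub)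
  have h3 := Finset.card_sdiff_add_card_eq_card hLW
  omega

open Classical in
theorem main (G : SimpleGraph V) (c : ℕ) (hc : 2 ≤ c)
    (hl : ∀ (x : V) (w' : G.Walk x x), w'.IsCycle → w'.length ≤ c)
    (n : ℕ) : ∀ S : Finset V, S.card = n → S.Nonempty →
      ∑ x ∈ S, (S.filter (G.Adj x)).card + c ≤ c * S.card := by
  induction n using Nat.strong_induction_on with
  | _ n ih =>
  intro S hS hne
  by_cases hE : ∃ a ∈ S, ∃ b ∈ S, G.Adj a b
  · obtain ⟨a, ha, b, hb, hab⟩ := hE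
    obtain ⟨L, hLS, hL, hSL, hdeg⟩ := key G c hc hl S a b ha hb hab
    have hcard := Finset.card_sdiff_add_card_eq_card hLS
    have hLpos := hL.card_pos
    have hi := ih (S \ L).card (by omega) (S \ L) rfl hSL
    have e1 : ∑ x ∈ S, (S.filter (G.Adj x)).card
        = ∑ x ∈ S \ L, (S.filter (G.Adj x)).card + ∑ x ∈ L, (S.filter (G.Adj x)).card :=
      (Finset.sum_sdiff hLS).symm
    have e2 : ∑ x ∈ S \ L, (S.filter (G.Adj x)).card
        = ∑ x ∈ S \ L, ((S \ L).filter (G.Adj x)).card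
          + ∑ x ∈ S \ L, (L.filter (G.Adj x)).card := by
      rw [← Finset.sum_add_distrib]
      refine Finset.sum_congr rfl fun x _ => ?_
      rw [← Finset.card_union_of_disjoint, ← Finset.filter_union, Finset.sdiff_union_of_subset hLS]
      exact Finset.disjoint_filter_filter Finset.sdiff_disjoint
    have e3 : ∑ x ∈ S \ L, (L.filter (G.Adj x)).card
        = ∑ x ∈ L, ((S \ L).filter (G.Adj x)).card := by
      simp only [Finset.card_filter]
      rw [Finset.sum_comm]
      simp only [G.adj_comm]
    have e4 := Finset.sum_le_card_nsmul L _ c hdeg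
    rw [Finset.sum_add_distrib, smul_eq_mul] at e4
    have : c * S.card = c * (S \ L).card + L.card * c := by rw [← hcard]; ring
    omega
  · have : ∑ x ∈ S, (S.filter (G.Adj x)).card = 0 := by
      refine Finset.sum_eq_zero fun x hx => ?_
      rw [Finset.card_eq_zero, Finset.filter_eq_empty_iff]
      intro y hy h
      exact hE ⟨x, hx, y, hy, h⟩
    rw [this, zero_add]
    exact Nat.le_mul_of_pos_right c hne.card_pos

open Classical in
theorem edge_bound [Fintype V] (G : SimpleGraph V) (c : ℕ) (hc : 2 ≤ c)
    (hl : ∀ (x : V) (w' : G.Walk x x), w'.IsCycle → w'.length ≤ c) [Nonempty V] :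
    2 * edgeCount G + c ≤ c * Fintype.card V := by
  have h := main G c hc hl _ Finset.univ rfl Finset.univ_nonempty
  have h1 : ∑ x : V, (Finset.univ.filter (G.Adj x)).card = 2 * edgeCount G := by
    have h2 : edgeCount G = G.edgeFinset.card := by
      unfold edgeCount
      rw [← SimpleGraph.coe_edgeFinset, Set.ncard_coe_finset]
    rw [h2, ← SimpleGraph.sum_degrees_eq_twice_card_edges]
    refine Finset.sum_congr rfl fun x _ => ?_
    rw [← SimpleGraph.card_neighborFinset_eq_degree, SimpleGraph.neighborFinset_eq_filter]
  rw [h1] at h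
  simpa using h

end EG


/-- Edge bound for short longest cycles: for `k ≥ 5`, `t = ⌊(k-1)/2⌋`, a
2-connected `𝓒_{≥k}`-free graph `G` whose longest cycle has length `c` with
either `c ≤ k−3`, or `c = k−2` and `k` odd, satisfies
`e(G) ≤ (t − 1/2)(n − 1)`. -/
theorem stmt12 {V : Type*} [Fintype V] (k : ℕ) (hk : 5 ≤ k)
    (G : SimpleGraph V) (hG2 : TwoConnected G) (hGk : ¬ HasCycleGE G k)
    (v : V) (w : G.Walk v v) (hw : w.IsCycle) (c : ℕ) (hlen : w.length = c)
    (hlongest : ∀ (x : V) (w' : G.Walk x x), w'.IsCycle → w'.length ≤ c)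
    (hc : c ≤ k - 3 ∨ (c = k - 2 ∧ Odd k)) :
    (edgeCount G : ℝ)
      ≤ ((↑((k - 1) / 2) : ℝ) - 1 / 2) * ((Fintype.card V : ℝ) - 1) := by
  have h3 : 3 ≤ c := hlen ▸ hw.three_le_length
  have : Nonempty V := ⟨v⟩
  have hb := EG.edge_bound G c (by omega) hlongest
  have ht : c + 1 ≤ 2 * ((k - 1) / 2) := by
    rcases hc with hc | ⟨hc, ⟨r, hr⟩⟩ <;> omega
  have hn : 1 ≤ Fintype.card V := Fintype.card_pos
  have hb' : (2 * edgeCount G + c : ℝ) ≤ c * Fintype.card V := by exact_mod_cast hb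
  have ht' : (c + 1 : ℝ) ≤ 2 * (((k - 1) / 2 : ℕ) : ℝ) := by exact_mod_cast ht
  have hn' : (1 : ℝ) ≤ Fintype.card V := by exact_mod_cast hn
  nlinarith [mul_le_mul_of_nonneg_right ht' (sub_nonneg.2 hn')]
end
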